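/- (Lacey–Sawyer–Uriarte-Tuero two-weight characterization.) Let 1 < p ≤ q < ∞ and let ω, σ be weights on ℝⁿ. Let 𝒟 be a collection of dyadic cubes, let (τ_Q)_{Q∈𝒟} be nonnegative reals, and define the positive dyadic operator T(f) := Σ_{Q∈𝒟} τ_Q ⟨f⟩_Q 1_Q, where ⟨f⟩_Q = |Q|^{−1}∫_Q f. Then the operator norm ‖T(·σ)‖_{L^p_σ → L^q_ω} (the least K with ‖T(fσ)‖_{L^q_ω} ≤ K‖f‖_{L^p_σ} for all f ∈ L^p_σ) is comparable, with constants depending only on p and q, to sup_{R∈𝒟} ω(R)^{−1/q'} ‖Σ_{Q∈𝒟, Q⊆R} τ_Q ⟨ω⟩_Q 1_Q‖_{L^{p'}_σ} + sup_{R∈𝒟} σ(R)^{−1/p} ‖Σ_{Q∈𝒟, Q⊆R} τ_Q ⟨σ⟩_Q 1_Q‖_{L^q_ω}. -/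

import Mathlib

open MeasureTheory ENNReal Set

noncomputable section

/-- An axis-parallel (closed) cube in ℝⁿ with corner `corner` and side length `side > 0`. -/
structure Cube (n : ℕ) where
  corner : Fin n → ℝ
  side : ℝ
  side_pos : 0 < side

namespace Cube

/-- The set of points of the cube. -/
def carrier {n : ℕ} (Q : Cube n) : Set (Fin n → ℝ) :=
  {x | ∀ i, Q.corner i ≤ x i ∧ x i ≤ Q.corner i + Q.side}

/-- The volume `|Q|` of the cube. -/
def vol {n : ℕ} (Q : Cube n) : ℝ := Q.side ^ n

/-- `Q` is a cube of the standard dyadic grid: `Q = 2^{-j}([0,1]^n + m)`. -/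
def IsDyadic {n : ℕ} (Q : Cube n) : Prop :=
  ∃ (j : ℤ) (m : Fin n → ℤ),
    Q.side = (2 : ℝ) ^ (-j) ∧ ∀ i, Q.corner i = (m i : ℝ) * (2 : ℝ) ^ (-j)

end Cube

/-- `η`-sparseness of a collection of cubes: there are pairwise disjoint measurable
subsets `E Q ⊆ Q` with `|E Q| ≥ η |Q|`. -/
def IsSparse {n : ℕ} (η : ℝ) (S : Set (Cube n)) : Prop :=
  ∃ E : Cube n → Set (Fin n → ℝ),
    (∀ Q ∈ S, MeasurableSet (E Q)) ∧ (∀ Q ∈ S, E Q ⊆ Q.carrier) ∧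
    (S.Pairwise (fun Q Q' => Disjoint (E Q) (E Q'))) ∧
    (∀ Q ∈ S, ENNReal.ofReal (η * Q.vol) ≤ volume (E Q))

/-- A weight: a nonnegative locally integrable function on ℝⁿ. -/
def IsWeight {n : ℕ} (w : (Fin n → ℝ) → ℝ) : Prop :=
  MeasureTheory.LocallyIntegrable w volume ∧ ∀ x, 0 ≤ w x

/-- `ω(Q) = ∫_Q ω`. -/
def wMass {n : ℕ} (w : (Fin n → ℝ) → ℝ) (Q : Cube n) : ℝ≥0∞ :=
  ∫⁻ x in Q.carrier, ENNReal.ofReal (w x)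

/-- The weighted `L^s` (quasi)norm `‖f‖_{L^s_w} = (∫ |f|^s w)^{1/s}`, valued in `ℝ≥0∞`. -/
def wNorm {n : ℕ} (s : ℝ) (w f : (Fin n → ℝ) → ℝ) : ℝ≥0∞ :=
  (∫⁻ x, ENNReal.ofReal (|f x| ^ s) * ENNReal.ofReal (w x)) ^ (1 / s)

/-- The weighted `L^s` (quasi)norm of an `ℝ≥0∞`-valued function. -/
def eNorm {n : ℕ} (s : ℝ) (w : (Fin n → ℝ) → ℝ) (g : (Fin n → ℝ) → ℝ≥0∞) : ℝ≥0∞ :=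
  (∫⁻ x, g x ^ s * ENNReal.ofReal (w x)) ^ (1 / s)

/-- `Σ_{Q ∈ D} g(Q) 1_Q`. -/
def cubeSum {n : ℕ} (D : Set (Cube n)) (g : Cube n → ℝ≥0∞) (x : Fin n → ℝ) : ℝ≥0∞ :=
  ∑' Q : D, Q.1.carrier.indicator (fun _ => g Q.1) x

/-- The sparse operator `A^{r,α}_S f = (Σ_{Q∈S} (|Q|^{-α} ∫_Q f)^r 1_Q)^{1/r}`
(for nonnegative `f`; negative values are truncated). -/
def sparseOp {n : ℕ} (S : Set (Cube n)) (r α : ℝ) (f : (Fin n → ℝ) → ℝ)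
    (x : Fin n → ℝ) : ℝ≥0∞ :=
  (cubeSum S
      (fun Q => ((ENNReal.ofReal Q.vol) ^ (-α) * ∫⁻ y in Q.carrier, ENNReal.ofReal (f y)) ^ r)
      x) ^ (1 / r)

/-- The Hardy–Littlewood maximal function over axis-parallel cubes. -/
def maximal {n : ℕ} (w : (Fin n → ℝ) → ℝ) (x : Fin n → ℝ) : ℝ≥0∞ :=
  ⨆ (Q : Cube n) (_ : x ∈ Q.carrier),
    (ENNReal.ofReal Q.vol)⁻¹ * ∫⁻ y in Q.carrier, ENNReal.ofReal |w y|

/-- The Fujii–Wilson `A∞`-characteristic `[w]_{A∞} = sup_Q ω(Q)⁻¹ ∫_Q M(1_Q ω)`. -/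
def AinfChar {n : ℕ} (w : (Fin n → ℝ) → ℝ) : ℝ≥0∞ :=
  ⨆ Q : Cube n, (wMass w Q)⁻¹ * ∫⁻ x in Q.carrier, maximal (Q.carrier.indicator w) x

/-- The two-weight characteristic
`[ω,σ]_{A^α_{pq}(S)} = sup_{Q∈S} |Q|^{-α} ω(Q)^{1/q} σ(Q)^{1/p'}` (here `1/p' = 1 - 1/p`). -/
def twoWeightChar {n : ℕ} (p q α : ℝ) (S : Set (Cube n)) (w σ' : (Fin n → ℝ) → ℝ) : ℝ≥0∞ :=
  ⨆ Q ∈ S, (ENNReal.ofReal Q.vol) ^ (-α) * wMass w Q ^ (1 / q) * wMass σ' Q ^ (1 - 1 / p)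

/-- The one-weight characteristic
`[w]_{A_{pq}} = sup_Q (|Q|⁻¹ ∫_Q w^q)(|Q|⁻¹ ∫_Q w^{-p'})^{q/p'}`, `p' = p/(p-1)`. -/
def ApqChar {n : ℕ} (p q : ℝ) (w : (Fin n → ℝ) → ℝ) : ℝ≥0∞ :=
  ⨆ Q : Cube n,
    ((ENNReal.ofReal Q.vol)⁻¹ * ∫⁻ x in Q.carrier, (ENNReal.ofReal (w x)) ^ q) *
      ((ENNReal.ofReal Q.vol)⁻¹ *
          ∫⁻ x in Q.carrier, (ENNReal.ofReal (w x)) ^ (-(p / (p - 1)))) ^ (q / (p / (p - 1)))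

/-- The testing constant `𝒯`. -/
def testT {n : ℕ} (p q r α : ℝ) (S : Set (Cube n)) (w σ' : (Fin n → ℝ) → ℝ) : ℝ≥0∞ :=
  ⨆ R ∈ S,
    wMass σ' R ^ (-(r / p)) *
      eNorm (q / r) w
        (cubeSum {Q | Q ∈ S ∧ Q.carrier ⊆ R.carrier}
          (fun Q => (ENNReal.ofReal Q.vol) ^ (-(α * r)) * wMass σ' Q ^ r))

/-- The testing constant `𝒯*`; here `1/(q/r)' = 1 - r/q` and `(p/r)' = (p/r)/((p/r)-1)`. -/
def testTstar {n : ℕ} (p q r α : ℝ) (S : Set (Cube n)) (w σ' : (Fin n → ℝ) → ℝ) : ℝ≥0∞ :=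
  ⨆ R ∈ S,
    wMass w R ^ (-(1 - r / q)) *
      eNorm ((p / r) / (p / r - 1)) σ'
        (cubeSum {Q | Q ∈ S ∧ Q.carrier ⊆ R.carrier}
          (fun Q => (ENNReal.ofReal Q.vol) ^ (-(α * r)) * wMass σ' Q ^ (r - 1) * wMass w Q))

/-- The operator (quasi)norm of `A^{r,α}_S(·σ) : L^p_σ → L^q_ω`, i.e. the least constant `K`
with `‖A^{r,α}_S(fσ)‖_{L^q_ω} ≤ K ‖f‖_{L^p_σ}` for all `f`. -/
def sparseOpNorm {n : ℕ} (p q r α : ℝ) (S : Set (Cube n)) (w σ' : (Fin n → ℝ) → ℝ) : ℝ≥0∞ :=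
  sInf {K : ℝ≥0∞ | ∀ f : (Fin n → ℝ) → ℝ, Measurable f →
    eNorm q w (sparseOp S r α (fun y => f y * σ' y)) ≤ K * wNorm p σ' f}

/-- The positive dyadic operator `T(fσ) = Σ_{Q∈D} τ_Q ⟨fσ⟩_Q 1_Q`. -/
def lsuOp {n : ℕ} (D : Set (Cube n)) (τ : Cube n → ℝ) (σ' : (Fin n → ℝ) → ℝ)
    (f : (Fin n → ℝ) → ℝ) : (Fin n → ℝ) → ℝ≥0∞ :=
  cubeSum D fun Q =>
    ENNReal.ofReal (τ Q) *
      ((ENNReal.ofReal Q.vol)⁻¹ * ∫⁻ y in Q.carrier, ENNReal.ofReal (f y * σ' y))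

/-- The operator norm `‖T(·σ)‖_{L^p_σ → L^q_ω}`: the least `K` with
`‖T(fσ)‖_{L^q_ω} ≤ K ‖f‖_{L^p_σ}` for all `f`. -/
def lsuNorm {n : ℕ} (p q : ℝ) (D : Set (Cube n)) (τ : Cube n → ℝ)
    (ω σ' : (Fin n → ℝ) → ℝ) : ℝ≥0∞ :=
  sInf {K : ℝ≥0∞ | ∀ f : (Fin n → ℝ) → ℝ, Measurable f →
    eNorm q ω (lsuOp D τ σ' f) ≤ K * wNorm p σ' f}

/-- `sup_{R∈D} ω(R)^{-1/q'} ‖Σ_{Q∈D, Q⊆R} τ_Q ⟨ω⟩_Q 1_Q‖_{L^{p'}_σ}` (`1/q' = 1 - 1/q`,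
`p' = p/(p-1)`). -/
def lsuT1 {n : ℕ} (p q : ℝ) (D : Set (Cube n)) (τ : Cube n → ℝ)
    (ω σ' : (Fin n → ℝ) → ℝ) : ℝ≥0∞ :=
  ⨆ R ∈ D, wMass ω R ^ (-(1 - 1 / q)) *
    eNorm (p / (p - 1)) σ'
      (cubeSum {Q | Q ∈ D ∧ Q.carrier ⊆ R.carrier} fun Q =>
        ENNReal.ofReal (τ Q) * ((ENNReal.ofReal Q.vol)⁻¹ * wMass ω Q))

/-- `sup_{R∈D} σ(R)^{-1/p} ‖Σ_{Q∈D, Q⊆R} τ_Q ⟨σ⟩_Q 1_Q‖_{L^q_ω}`. -/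
def lsuT2 {n : ℕ} (p q : ℝ) (D : Set (Cube n)) (τ : Cube n → ℝ)
    (ω σ' : (Fin n → ℝ) → ℝ) : ℝ≥0∞ :=
  ⨆ R ∈ D, wMass σ' R ^ (-(1 / p)) *
    eNorm q ω
      (cubeSum {Q | Q ∈ D ∧ Q.carrier ⊆ R.carrier} fun Q =>
        ENNReal.ofReal (τ Q) * ((ENNReal.ofReal Q.vol)⁻¹ * wMass σ' Q))

section LaminarFamilies

variable {X : Type*}

/-- The constant `(1 - 2^{-s})⁻¹`, the sum of a geometric series of ratio `2^{-s}`. -/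
def geomConst (s : ℝ) : ℝ≥0∞ := (1 - (2 : ℝ≥0∞) ^ (-s))⁻¹

lemma two_rpow_neg_lt_one {s : ℝ} (hs : 0 < s) : (2 : ℝ≥0∞) ^ (-s) < 1 :=
  ENNReal.rpow_lt_one_of_one_lt_of_neg (by norm_num) (by linarith)

lemma geomConst_ne_top {s : ℝ} (hs : 0 < s) : geomConst s ≠ ⊤ :=
  ENNReal.inv_ne_top.2 (tsub_pos_of_lt (two_rpow_neg_lt_one hs)).ne'

lemma one_add_geomConst {s : ℝ} (hs : 0 < s) :
    1 + geomConst s * (2 : ℝ≥0∞) ^ (-s) = geomConst s := by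
  have h1 := two_rpow_neg_lt_one hs
  have h : geomConst s * (1 - (2 : ℝ≥0∞) ^ (-s)) = 1 :=
    ENNReal.inv_mul_cancel (tsub_pos_of_lt h1).ne' (by simp)
  nth_rw 1 [← h]
  rw [← mul_add, tsub_add_cancel_of_le h1.le, mul_one]

/-- A finite family of numbers any two of which differ by more than a factor `2` has its
`s`-th powers summing like a geometric series. -/
lemma sum_rpow_le_of_doubling {ι : Type*} {s : ℝ} (hs : 0 < s) (a : ι → ℝ≥0∞) (c : Finset ι) :
    ∀ M : ℝ≥0∞, (∀ i ∈ c, a i ≤ M) →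
      (∀ i ∈ c, ∀ j ∈ c, i ≠ j → 2 * a i < a j ∨ 2 * a j < a i) →
      ∑ i ∈ c, a i ^ s ≤ geomConst s * M ^ s := by
  classical
  induction c using Finset.strongInduction with
  | H c ih =>
    intro M hM hc
    rcases c.eq_empty_or_nonempty with rfl | hne
    · simp
    obtain ⟨i, hi, hmax⟩ := Finset.exists_max_image c a hne
    have key : ∀ j ∈ c.erase i, a j ≤ 2⁻¹ * M := by
      intro j hj
      obtain ⟨hji, hj⟩ := Finset.mem_erase.1 hj
      have h2 : 2 * a j ≤ M := by
        rcases hc i hi j hj (Ne.symm hji) with h | h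
        · exfalso
          have : a i ≤ 2 * a i := le_mul_of_one_le_left (zero_le) (by norm_num)
          exact absurd (this.trans_lt h) (not_lt.2 (hmax j hj))
        · exact h.le.trans (hM i hi)
      calc a j = 2⁻¹ * (2 * a j) := by
            rw [← mul_assoc, ENNReal.inv_mul_cancel (by norm_num) (by norm_num), one_mul]
        _ ≤ 2⁻¹ * M := by gcongr
    have h := ih _ (Finset.erase_ssubset hi) (2⁻¹ * M) key
      (fun x hx y hy => hc x (Finset.mem_of_mem_erase hx) y (Finset.mem_of_mem_erase hy))
    rw [← Finset.add_sum_erase c _ hi]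
    calc a i ^ s + ∑ x ∈ c.erase i, a x ^ s
        ≤ M ^ s + geomConst s * (2⁻¹ * M) ^ s := by
          gcongr
          exact hM i hi
      _ = (1 + geomConst s * (2 : ℝ≥0∞) ^ (-s)) * M ^ s := by
          rw [ENNReal.mul_rpow_of_nonneg _ _ hs.le, ENNReal.inv_rpow, ← ENNReal.rpow_neg]
          ring
      _ = geomConst s * M ^ s := by rw [one_add_geomConst hs]

lemma sum_rpow_le_rpow_sum {ι : Type*} (s : Finset ι) (f : ι → ℝ≥0∞) {t : ℝ} (ht : 1 ≤ t) :
    ∑ i ∈ s, f i ^ t ≤ (∑ i ∈ s, f i) ^ t := by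
  classical
  induction s using Finset.induction_on with
  | empty => simp
  | insert i s hi ih =>
    rw [Finset.sum_insert hi, Finset.sum_insert hi]
    exact (by gcongr : _ ≤ f i ^ t + (∑ i ∈ s, f i) ^ t).trans
      (ENNReal.add_rpow_le_rpow_add _ _ ht)

/-- A finite family of nonempty sets, any two of which are nested or disjoint. -/
def Laminar (A : Finset (Set X)) : Prop :=
  (∀ Q ∈ A, Q.Nonempty) ∧ ∀ Q ∈ A, ∀ R ∈ A, Q ⊆ R ∨ R ⊆ Q ∨ Disjoint Q R

lemma Laminar.mono {A B : Finset (Set X)} (hA : Laminar A) (h : B ⊆ A) : Laminar B :=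
  ⟨fun Q hQ => hA.1 Q (h hQ), fun Q hQ R hR => hA.2 Q (h hQ) R (h hR)⟩

lemma Laminar.subset_or_subset {A : Finset (Set X)} (hA : Laminar A) {Q R : Set X} (hQ : Q ∈ A)
    (hR : R ∈ A) {x : X} (hxQ : x ∈ Q) (hxR : x ∈ R) : Q ⊆ R ∨ R ⊆ Q := by
  rcases hA.2 Q hQ R hR with h | h | h
  · exact Or.inl h
  · exact Or.inr h
  · exact (Set.disjoint_left.1 h hxQ hxR).elim

/-- Principal sets: a subfamily along which `a` more than doubles, and which controls `a`. -/
lemma exists_principal (a : Set X → ℝ≥0∞) (A : Finset (Set X)) :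
    ∃ P ⊆ A, (∀ Q ∈ A, ∃ F ∈ P, Q ⊆ F ∧ a Q ≤ 2 * a F) ∧
      ∀ F ∈ P, ∀ G ∈ P, G ⊂ F → 2 * a F < a G := by
  classical
  induction A using Finset.strongInduction with
  | H A ih =>
    rcases A.eq_empty_or_nonempty with rfl | hne
    · exact ⟨∅, by simp⟩
    obtain ⟨Q₀, hQ₀⟩ := Finset.exists_minimal hne
    obtain ⟨P, hPA, hP, hd⟩ := ih _ (Finset.erase_ssubset hQ₀.prop)
    have hPA' : P ⊆ A := hPA.trans (Finset.erase_subset _ _)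
    by_cases h : ∃ F ∈ P, Q₀ ⊆ F ∧ a Q₀ ≤ 2 * a F
    · refine ⟨P, hPA', fun Q hQ => ?_, hd⟩
      by_cases hQQ : Q = Q₀
      · exact hQQ ▸ h
      · exact hP Q (Finset.mem_erase.2 ⟨hQQ, hQ⟩)
    · push Not at h
      refine ⟨insert Q₀ P, Finset.insert_subset hQ₀.prop hPA', fun Q hQ => ?_, ?_⟩
      · by_cases hQQ : Q = Q₀
        · exact ⟨Q₀, Finset.mem_insert_self _ _, hQQ.le,
            hQQ ▸ le_mul_of_one_le_left (zero_le) (by norm_num)⟩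
        · obtain ⟨F, hF, h'⟩ := hP Q (Finset.mem_erase.2 ⟨hQQ, hQ⟩)
          exact ⟨F, Finset.mem_insert_of_mem hF, h'⟩
      · intro F hF G hG hGF
        rcases Finset.mem_insert.1 hF with rfl | hF
        · rcases Finset.mem_insert.1 hG with rfl | hG
          · exact (ssubset_irrefl _ hGF).elim
          · exact (hGF.2 (hQ₀.le_of_le (hPA' hG) hGF.1)).elim
        · rcases Finset.mem_insert.1 hG with hGQ | hG
          · rw [hGQ] at hGF ⊢
            exact h F hF hGF.1
          · exact hd F hF G hG hGF

/-- Principal sets together with the map sending a set to the least principal set above it. -/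
lemma Laminar.exists_principal_parent {A : Finset (Set X)} (hA : Laminar A)
    (a : Set X → ℝ≥0∞) :
    ∃ P ⊆ A, ∃ π : Set X → Set X,
      (∀ Q ∈ A, π Q ∈ P ∧ Q ⊆ π Q ∧ a Q ≤ 2 * a (π Q) ∧ ∀ F ∈ P, Q ⊆ F → π Q ⊆ F) ∧
      ∀ F ∈ P, ∀ G ∈ P, G ⊂ F → 2 * a F < a G := by
  classical
  obtain ⟨P, hPA, hP, hd⟩ := exists_principal a A
  have key : ∀ Q, ∃ F, Q ∈ A → F ∈ P ∧ Q ⊆ F ∧ a Q ≤ 2 * a F ∧ ∀ G ∈ P, Q ⊆ G → F ⊆ G := by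
    intro Q
    by_cases hQ : Q ∈ A
    swap
    · exact ⟨Q, fun h => (hQ h).elim⟩
    obtain ⟨F₀, hF₀, hQF₀, haF₀⟩ := hP Q hQ
    obtain ⟨x, hx⟩ := hA.1 Q hQ
    obtain ⟨F, hFF₀, hF⟩ := Finset.exists_le_minimal (P.filter (Q ⊆ ·))
      (Finset.mem_filter.2 ⟨hF₀, hQF₀⟩)
    obtain ⟨hFP, hQF⟩ := Finset.mem_filter.1 hF.prop
    refine ⟨F, fun _ => ⟨hFP, hQF, ?_, fun G hG hQG => ?_⟩⟩
    · rcases hFF₀.eq_or_lt with h | h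
      · exact h ▸ haF₀
      · refine haF₀.trans ((hd F₀ hF₀ F hFP h).le.trans ?_)
        exact le_mul_of_one_le_left (zero_le) (by norm_num)
    · rcases hA.subset_or_subset (hPA hFP) (hPA hG) (hQF hx) (hQG hx) with h | h
      · exact h
      · exact hF.le_of_le (Finset.mem_filter.2 ⟨hG, hQG⟩) h
  choose π hπ using key
  exact ⟨P, hPA, π, fun Q hQ => hπ Q hQ, hd⟩

open Classical in
/-- The maximal elements of `P` strictly inside `F`. -/
def children (P : Finset (Set X)) (F : Set X) : Finset (Set X) :=
  P.filter fun G => G ⊂ F ∧ ∀ H ∈ P, G ⊂ H → F ⊆ H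

/-- The part of `F` not covered by the elements of `P` strictly inside `F`. -/
def uncovered (P : Finset (Set X)) (F : Set X) : Set X :=
  {x | x ∈ F ∧ ∀ G ∈ P, G ⊂ F → x ∉ G}

lemma mem_children {P : Finset (Set X)} {F G : Set X} :
    G ∈ children P F ↔ G ∈ P ∧ G ⊂ F ∧ ∀ H ∈ P, G ⊂ H → F ⊆ H := by
  simp [children]

lemma Laminar.exists_child {P : Finset (Set X)} (hP : Laminar P) {F G : Set X} (hF : F ∈ P)
    (hG : G ∈ P) (hGF : G ⊂ F) : ∃ H ∈ children P F, G ⊆ H := by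
  classical
  obtain ⟨H, hGH, hH⟩ := Finset.exists_le_maximal (P.filter (· ⊂ F))
    (Finset.mem_filter.2 ⟨hG, hGF⟩)
  obtain ⟨hHP, hHF⟩ := Finset.mem_filter.1 hH.prop
  refine ⟨H, mem_children.2 ⟨hHP, hHF, fun K hK hHK => ?_⟩, hGH⟩
  obtain ⟨x, hx⟩ := hP.1 H hHP
  rcases hP.subset_or_subset hF hK (hHF.1 hx) (hHK.1 hx) with h | h
  · exact h
  · rcases h.eq_or_ssubset with h' | h'
    · exact h'.ge
    · exact (hHK.2 (hH.le_of_ge (Finset.mem_filter.2 ⟨hK, h'⟩) hHK.1)).elim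

lemma Laminar.children_eq_of_mem {P : Finset (Set X)} (hP : Laminar P) {F G H : Set X}
    (hG : G ∈ children P F) (hH : H ∈ children P F) {x : X} (hxG : x ∈ G) (hxH : x ∈ H) :
    G = H := by
  obtain ⟨hGP, hGF, hG⟩ := mem_children.1 hG
  obtain ⟨hHP, hHF, hH⟩ := mem_children.1 hH
  rcases hP.subset_or_subset hGP hHP hxG hxH with h | h
  · exact h.eq_or_ssubset.resolve_right fun h' => hHF.2 (hG H hHP h')
  · exact (h.eq_or_ssubset.resolve_right fun h' => hGF.2 (hH G hGP h')).symm

lemma parent_unique {P : Finset (Set X)} {F F' G : Set X} (hF : F ∈ P) (hF' : F' ∈ P)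
    (h : G ∈ children P F) (h' : G ∈ children P F') : F = F' := by
  obtain ⟨-, hGF, hG⟩ := mem_children.1 h
  obtain ⟨-, hGF', hG'⟩ := mem_children.1 h'
  exact (hG F' hF' hGF').antisymm (hG' F hF hGF)

lemma sum_children_le {P : Finset (Set X)} (φ : Set X → ℝ≥0∞) :
    ∑ F ∈ P, ∑ G ∈ children P F, φ G ≤ ∑ G ∈ P, φ G := by
  classical
  rw [← Finset.sum_biUnion]
  · refine Finset.sum_le_sum_of_subset fun G hG => ?_
    obtain ⟨F, -, hG⟩ := Finset.mem_biUnion.1 hG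
    exact (mem_children.1 hG).1
  · intro F hF F' hF' hne
    exact Finset.disjoint_left.2 fun G h h' => hne (parent_unique hF hF' h h')

lemma uncovered_eq_of_mem {P : Finset (Set X)} (hP : Laminar P) {F F' : Set X} (hF : F ∈ P)
    (hF' : F' ∈ P) {x : X} (h : x ∈ uncovered P F) (h' : x ∈ uncovered P F') : F = F' := by
  rcases hP.subset_or_subset hF hF' h.1 h'.1 with hs | hs
  · exact hs.eq_or_ssubset.resolve_right fun hss => h'.2 F hF hss h.1
  · exact (hs.eq_or_ssubset.resolve_right fun hss => h.2 F' hF' hss h'.1).symm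

lemma measurableSet_uncovered [MeasurableSpace X] {P : Finset (Set X)}
    (hm : ∀ F ∈ P, MeasurableSet F) {F : Set X} (hF : F ∈ P) : MeasurableSet (uncovered P F) := by
  classical
  have : uncovered P F = F \ ⋃ G ∈ P.filter (· ⊂ F), G := by
    ext x
    simp only [uncovered, mem_ofPred_eq, mem_sdiff, mem_iUnion, Finset.mem_filter, not_exists]
    tauto
  rw [this]
  exact (hm F hF).diff
    (Finset.measurableSet_biUnion _ fun G hG => hm G (Finset.mem_filter.1 hG).1)

variable [MeasurableSpace X]

lemma setLIntegral_le_rpow {μ : Measure X} {p p' : ℝ} (hp : p.HolderConjugate p') {f : X → ℝ≥0∞}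
    (hf : Measurable f) (Q : Set X) :
    ∫⁻ x in Q, f x ∂μ ≤ (∫⁻ x, f x ^ p ∂μ) ^ (1 / p) * μ Q ^ (1 / p') := by
  have h := ENNReal.lintegral_mul_le_Lp_mul_Lq (μ.restrict Q) hp hf.aemeasurable
    (aemeasurable_const (b := (1 : ℝ≥0∞)))
  simp only [Pi.mul_apply, mul_one, ENNReal.one_rpow, lintegral_const, Measure.restrict_apply,
    MeasurableSet.univ, univ_inter, one_mul] at h
  refine h.trans ?_
  gcongr
  · exact hp.one_div_nonneg
  · exact Measure.restrict_le_self

lemma lintegral_sum_indicator_mul {μ : Measure X} {B : Finset (Set X)}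
    (hB : ∀ Q ∈ B, MeasurableSet Q) (c : Set X → ℝ≥0∞) {h : X → ℝ≥0∞} (hh : Measurable h) :
    ∫⁻ x, (∑ Q ∈ B, Q.indicator (fun _ => c Q) x) * h x ∂μ =
      ∑ Q ∈ B, c Q * ∫⁻ x in Q, h x ∂μ := by
  simp_rw [Finset.sum_mul]
  have hm : ∀ Q ∈ B, Measurable fun x => Q.indicator (fun _ => c Q) x * h x :=
    fun Q hQ => (measurable_const.indicator (hB Q hQ)).mul hh
  rw [lintegral_finsetSum _ hm]
  refine Finset.sum_congr rfl fun Q hQ => ?_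
  rw [← lintegral_const_mul _ hh, ← lintegral_indicator (hB Q hQ)]
  refine lintegral_congr fun x => ?_
  by_cases hx : x ∈ Q <;> simp [hx]

lemma measurable_sum_indicator {B : Finset (Set X)}
    (hB : ∀ Q ∈ B, MeasurableSet Q) (c : Set X → ℝ≥0∞) :
    Measurable fun x => ∑ Q ∈ B, Q.indicator (fun _ => c Q) x :=
  Finset.measurable_sum _ fun Q hQ => measurable_const.indicator (hB Q hQ)

lemma lintegral_sum_indicator {μ : Measure X} {B : Finset (Set X)}
    (hB : ∀ Q ∈ B, MeasurableSet Q) (c : Set X → ℝ≥0∞) :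
    ∫⁻ x, ∑ Q ∈ B, Q.indicator (fun _ => c Q) x ∂μ = ∑ Q ∈ B, c Q * μ Q := by
  simpa using lintegral_sum_indicator_mul (μ := μ) hB c (measurable_const (a := (1 : ℝ≥0∞)))

/-- Hölder's inequality for the sets of a stopping family below `F`, after replacing `g` by its
averages on the children of `F`. -/
lemma Laminar.sum_mul_setLIntegral_le {μ : Measure X} {q q' : ℝ} (hq : q.HolderConjugate q')
    {P B : Finset (Set X)} (hP : Laminar P) (hPm : ∀ F ∈ P, MeasurableSet F)
    (hBm : ∀ Q ∈ B, MeasurableSet Q) {F : Set X} (hF : F ∈ P) (hB : ∀ Q ∈ B, Q ⊆ F)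
    (hPB : ∀ Q ∈ B, ∀ G ∈ P, G ⊂ F → ∀ x ∈ G, x ∈ Q → G ⊆ Q) (c : Set X → ℝ≥0∞)
    {g : X → ℝ≥0∞} (hg : Measurable g) (b : Set X → ℝ≥0∞)
    (hb : ∀ G ∈ P, b G * μ G = ∫⁻ x in G, g x ∂μ) :
    ∑ Q ∈ B, c Q * ∫⁻ x in Q, g x ∂μ ≤
      (∫⁻ x, (∑ Q ∈ B, Q.indicator (fun _ => c Q) x) ^ q ∂μ) ^ (1 / q) *
      (∫⁻ x in uncovered P F, g x ^ q' ∂μ + ∑ G ∈ children P F, μ G * b G ^ q') ^ (1 / q') := by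
  classical
  have hchm : ∀ G ∈ children P F, MeasurableSet G := fun G hG => hPm G (mem_children.1 hG).1
  have hUm := measurableSet_uncovered hPm hF
  set h : X → ℝ≥0∞ := fun x => (uncovered P F).indicator g x +
    ∑ G ∈ children P F, G.indicator (fun _ => b G) x with hh
  have hm1 : Measurable ((uncovered P F).indicator g) := hg.indicator hUm
  have hhm : Measurable h := hm1.add (measurable_sum_indicator hchm b)
  have h1 : ∀ Q ∈ B, ∫⁻ x in Q, g x ∂μ ≤ ∫⁻ x in Q, h x ∂μ := by
    intro Q hQ
    have hBC : ∀ G ∈ (children P F).filter (· ⊆ Q), MeasurableSet G :=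
      fun G hG => hchm G (Finset.mem_filter.1 hG).1
    calc ∫⁻ x in Q, g x ∂μ
        ≤ ∫⁻ x in Q, (uncovered P F).indicator g x +
            ∑ G ∈ (children P F).filter (· ⊆ Q), G.indicator g x ∂μ := by
          refine setLIntegral_mono' (hBm Q hQ) fun x hx => ?_
          by_cases hxU : x ∈ uncovered P F
          · simp [hxU]
          · have : ∃ G ∈ P, G ⊂ F ∧ x ∈ G := by
              by_contra hcon
              push Not at hcon
              exact hxU ⟨hB Q hQ hx, hcon⟩
            obtain ⟨G, hG, hGF, hxG⟩ := this
            obtain ⟨H, hH, hGH⟩ := hP.exists_child hF hG hGF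
            obtain ⟨hHP, hHF, -⟩ := mem_children.1 hH
            have hHQ := hPB Q hQ H hHP hHF x (hGH hxG) hx
            refine le_add_left ?_
            calc g x = H.indicator g x := by simp [hGH hxG]
              _ ≤ _ := Finset.single_le_sum (f := fun G : Set X => G.indicator g x)
                  (fun _ _ => zero_le) (Finset.mem_filter.2 ⟨hH, hHQ⟩)
      _ ≤ ∫⁻ x in Q, (uncovered P F).indicator g x ∂μ +
            ∑ G ∈ (children P F).filter (· ⊆ Q), ∫⁻ x in G, g x ∂μ := by
          rw [lintegral_add_left hm1, lintegral_finsetSum' _ fun G hG =>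
            (hg.indicator (hBC G hG)).aemeasurable]
          refine add_le_add le_rfl (Finset.sum_le_sum fun G hG => ?_)
          rw [lintegral_indicator (hBC G hG)]
          exact lintegral_mono' (Measure.restrict_mono le_rfl Measure.restrict_le_self) le_rfl
      _ = ∫⁻ x in Q, (uncovered P F).indicator g x +
            ∑ G ∈ (children P F).filter (· ⊆ Q), G.indicator (fun _ => b G) x ∂μ := by
          rw [lintegral_add_left hm1, lintegral_sum_indicator hBC]
          congr 1
          refine Finset.sum_congr rfl fun G hG => ?_
          obtain ⟨hG, hGQ⟩ := Finset.mem_filter.1 hG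
          rw [Measure.restrict_apply (hchm G hG), inter_eq_left.2 hGQ,
            hb G (mem_children.1 hG).1]
      _ ≤ ∫⁻ x in Q, h x ∂μ := by
          refine lintegral_mono fun x => ?_
          simp only [hh]
          gcongr
          exact Finset.filter_subset _ _
  have h2 : ∫⁻ x, h x ^ q' ∂μ =
      ∫⁻ x in uncovered P F, g x ^ q' ∂μ + ∑ G ∈ children P F, μ G * b G ^ q' := by
    have hq'0 : 0 < q' := hq.symm.pos
    have : ∀ x, h x ^ q' = (uncovered P F).indicator (fun x => g x ^ q') x +
        ∑ G ∈ children P F, G.indicator (fun _ => b G ^ q') x := by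
      intro x
      simp only [hh]
      by_cases hxc : ∃ G ∈ children P F, x ∈ G
      · obtain ⟨G, hG, hxG⟩ := hxc
        have hxU : x ∉ uncovered P F := fun hx =>
          hx.2 G (mem_children.1 hG).1 (mem_children.1 hG).2.1 hxG
        have hz : ∀ H ∈ children P F, H ≠ G → x ∉ H := fun H hH hne hxH =>
          hne (hP.children_eq_of_mem hH hG hxH hxG)
        rw [Finset.sum_eq_single_of_mem G hG fun H hH hne => by simp [hz H hH hne],
          Finset.sum_eq_single_of_mem G hG fun H hH hne => by simp [hz H hH hne]]
        simp [hxU, hxG]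
      · push Not at hxc
        rw [Finset.sum_eq_zero fun H hH => by simp [hxc H hH],
          Finset.sum_eq_zero fun H hH => by simp [hxc H hH]]
        by_cases hxU : x ∈ uncovered P F <;> simp [hxU, hq'0]
    simp_rw [this]
    rw [lintegral_add_left ((hg.pow_const _).indicator hUm), lintegral_indicator hUm,
      lintegral_sum_indicator hchm]
    simp_rw [mul_comm]
  calc ∑ Q ∈ B, c Q * ∫⁻ x in Q, g x ∂μ
      ≤ ∑ Q ∈ B, c Q * ∫⁻ x in Q, h x ∂μ :=
        Finset.sum_le_sum fun Q hQ => mul_le_mul' le_rfl (h1 Q hQ)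
    _ = ∫⁻ x, (∑ Q ∈ B, Q.indicator (fun _ => c Q) x) * h x ∂μ :=
        (lintegral_sum_indicator_mul hBm c hhm).symm
    _ ≤ _ := by
        rw [← h2]
        exact ENNReal.lintegral_mul_le_Lp_mul_Lq μ hq
          (measurable_sum_indicator hBm c).aemeasurable hhm.aemeasurable

lemma rpow_le_of_le_mul_rpow {p p' : ℝ} (hp : p.HolderConjugate p') {S K : ℝ≥0∞} (hS : S ≠ ⊤)
    (h : S ≤ K * S ^ (1 / p')) : S ^ (1 / p) ≤ K := by
  rcases eq_or_ne S 0 with rfl | h0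
  · simp [hp.pos]
  have hsum : 1 / p + 1 / p' = 1 := by simpa using hp.inv_add_inv_eq_one
  have hne : S ^ (1 / p') ≠ 0 := by simp [h0, hS]
  have hnt : S ^ (1 / p') ≠ ⊤ := by simp [h0, hS]
  refine (ENNReal.mul_le_mul_iff_left hne hnt).1 ?_
  rwa [← ENNReal.rpow_add _ _ h0 hS, hsum, ENNReal.rpow_one]

/-- Carleson embedding for the principal sets of `f`. -/
lemma carleson_embedding {μ : Measure X} {p p' : ℝ} (hp : p.HolderConjugate p')
    {P : Finset (Set X)} (hPm : ∀ F ∈ P, MeasurableSet F) (hμ : ∀ F ∈ P, μ F ≠ ⊤)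
    (a : Set X → ℝ≥0∞) (hat : ∀ F ∈ P, a F ≠ ⊤) {f : X → ℝ≥0∞} (hf : Measurable f)
    (ha : ∀ F ∈ P, a F * μ F = ∫⁻ x in F, f x ∂μ)
    (hd : ∀ F ∈ P, ∀ G ∈ P, F ≠ G → ∀ x ∈ F, x ∈ G → 2 * a F < a G ∨ 2 * a G < a F) :
    (∑ F ∈ P, a F ^ p * μ F) ^ (1 / p) ≤
      geomConst (p - 1) * (∫⁻ x, f x ^ p ∂μ) ^ (1 / p) := by
  classical
  have hp1 : 0 < p - 1 := hp.sub_one_pos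
  refine rpow_le_of_le_mul_rpow hp ?_ ?_
  · refine ENNReal.sum_ne_top.2 fun F hF => ENNReal.mul_ne_top ?_ (hμ F hF)
    exact ENNReal.rpow_ne_top_of_nonneg hp.nonneg (hat F hF)
  calc ∑ F ∈ P, a F ^ p * μ F
      = ∑ F ∈ P, a F ^ (p - 1) * ∫⁻ x in F, f x ∂μ := by
        refine Finset.sum_congr rfl fun F hF => ?_
        rw [← ha F hF, ← mul_assoc]
        congr 1
        rcases eq_or_ne (a F) 0 with h | h
        · simp [h, hp.pos]
        · nth_rw 3 [← ENNReal.rpow_one (a F)]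
          rw [← ENNReal.rpow_add _ _ h (hat F hF), sub_add_cancel]
    _ = ∫⁻ x, (∑ F ∈ P, F.indicator (fun _ => a F ^ (p - 1)) x) * f x ∂μ :=
        (lintegral_sum_indicator_mul hPm (fun F => a F ^ (p - 1)) hf).symm
    _ ≤ (∫⁻ x, (∑ F ∈ P, F.indicator (fun _ => a F ^ (p - 1)) x) ^ p' ∂μ) ^ (1 / p') *
          (∫⁻ x, f x ^ p ∂μ) ^ (1 / p) :=
        ENNReal.lintegral_mul_le_Lp_mul_Lq μ hp.symm
          (measurable_sum_indicator hPm _).aemeasurable hf.aemeasurable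
    _ ≤ (∫⁻ x, geomConst (p - 1) ^ p' * ∑ F ∈ P, F.indicator (fun _ => a F ^ p) x ∂μ) ^ (1 / p') *
          (∫⁻ x, f x ^ p ∂μ) ^ (1 / p) := by
        gcongr ?_ ^ _ * _
        · exact hp.symm.one_div_nonneg
        refine lintegral_mono fun x => ?_
        have hsum : ∀ s : ℝ, ∑ F ∈ P, F.indicator (fun _ => a F ^ s) x =
            ∑ F ∈ P.filter (x ∈ ·), a F ^ s := by
          intro s
          rw [Finset.sum_filter]
          exact Finset.sum_congr rfl fun F _ => by simp [Set.indicator_apply]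
        simp only [hsum]
        rcases (P.filter (x ∈ ·)).eq_empty_or_nonempty with he | hne
        · simp [he, hp.symm.pos]
        obtain ⟨F, hF, hmax⟩ := Finset.exists_max_image _ a hne
        have hle := sum_rpow_le_of_doubling hp1 a (P.filter (x ∈ ·)) (a F) hmax
          (fun G hG H hH hGH => by
            obtain ⟨hG, hxG⟩ := Finset.mem_filter.1 hG
            obtain ⟨hH, hxH⟩ := Finset.mem_filter.1 hH
            exact hd G hG H hH hGH x hxG hxH)
        calc (∑ F ∈ P.filter (x ∈ ·), a F ^ (p - 1)) ^ p'
            ≤ (geomConst (p - 1) * a F ^ (p - 1)) ^ p' := by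
              gcongr
              exact hp.symm.nonneg
          _ = geomConst (p - 1) ^ p' * a F ^ p := by
              rw [ENNReal.mul_rpow_of_nonneg _ _ hp.symm.nonneg, ← ENNReal.rpow_mul,
                hp.sub_one_mul_conj]
          _ ≤ _ := by
              gcongr
              exact Finset.single_le_sum (f := fun F => a F ^ p) (fun _ _ => zero_le) hF
    _ = geomConst (p - 1) * (∫⁻ x, f x ^ p ∂μ) ^ (1 / p) *
          (∑ F ∈ P, a F ^ p * μ F) ^ (1 / p') := by
        rw [lintegral_const_mul _ (measurable_sum_indicator hPm _), lintegral_sum_indicator hPm,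
          ENNReal.mul_rpow_of_nonneg _ _ hp.symm.one_div_nonneg, ← ENNReal.rpow_mul,
          mul_one_div_cancel hp.symm.ne_zero, ENNReal.rpow_one]
        ring

/-- The constant in the one-sided testing estimate. -/
def testingConst (p q' : ℝ) : ℝ≥0∞ :=
  2 * geomConst (p - 1) * (1 + geomConst (p - 1) ^ p) ^ (1 / q')

lemma testingConst_ne_top {p q' : ℝ} (hp : 1 < p) (hq' : 0 < q') : testingConst p q' ≠ ⊤ := by
  have h : geomConst (p - 1) ≠ ⊤ := geomConst_ne_top (by linarith)
  refine ENNReal.mul_ne_top (ENNReal.mul_ne_top (by norm_num) h)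
    (ENNReal.rpow_ne_top_of_nonneg (by positivity) ?_)
  exact ENNReal.add_ne_top.2 ⟨by norm_num, ENNReal.rpow_ne_top_of_nonneg (by linarith) h⟩

lemma conj_le_conj {p p' q q' : ℝ} (hp : p.HolderConjugate p') (hq : q.HolderConjugate q')
    (hpq : p ≤ q) : q' ≤ p' := by
  have h1 := hp.inv_add_inv_eq_one
  have h2 := hq.inv_add_inv_eq_one
  have h3 : q⁻¹ ≤ p⁻¹ := inv_anti₀ hp.pos hpq
  exact (inv_le_inv₀ hp.symm.pos hq.symm.pos).1 (by linarith)

/-- The two-weight testing estimate for a family on which the averages of `g` are dominated by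
those of `f`; only one testing condition is needed. -/
lemma Laminar.bilinear_le_of_dominated {p p' q q' : ℝ} (hp : p.HolderConjugate p')
    (hq : q.HolderConjugate q') (hpq : p ≤ q) {σ ω : Measure X} {A : Finset (Set X)}
    (hA : Laminar A) (hm : ∀ Q ∈ A, MeasurableSet Q)
    (hσ : ∀ Q ∈ A, σ Q ≠ 0 ∧ σ Q ≠ ⊤) (hω : ∀ Q ∈ A, ω Q ≠ 0 ∧ ω Q ≠ ⊤)
    (lam : Set X → ℝ≥0∞) (T : ℝ≥0∞)
    (hT : ∀ R ∈ A, ∀ B ⊆ A, (∀ Q ∈ B, Q ⊆ R) →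
      (∫⁻ x, (∑ Q ∈ B, Q.indicator (fun _ => lam Q * σ Q) x) ^ q ∂ω) ^ (1 / q) ≤
        T * σ R ^ (1 / p))
    {f g : X → ℝ≥0∞} (hf : Measurable f) (hg : Measurable g) (hf1 : ∫⁻ x, f x ^ p ∂σ ≤ 1)
    (hg1 : ∫⁻ x, g x ^ q' ∂ω ≤ 1)
    (hfg : ∀ Q ∈ A, ω Q * ((ω Q)⁻¹ * ∫⁻ x in Q, g x ∂ω) ^ q' ≤
      σ Q * ((σ Q)⁻¹ * ∫⁻ x in Q, f x ∂σ) ^ p) :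
    ∑ Q ∈ A, lam Q * (∫⁻ x in Q, f x ∂σ) * ∫⁻ x in Q, g x ∂ω ≤ testingConst p q' * T := by
  classical
  set a : Set X → ℝ≥0∞ := fun Q => (σ Q)⁻¹ * ∫⁻ x in Q, f x ∂σ with ha_def
  set b : Set X → ℝ≥0∞ := fun Q => (ω Q)⁻¹ * ∫⁻ x in Q, g x ∂ω with hb_def
  have ha : ∀ Q ∈ A, a Q * σ Q = ∫⁻ x in Q, f x ∂σ := fun Q hQ => by
    rw [ha_def, mul_comm, ← mul_assoc, ENNReal.mul_inv_cancel (hσ Q hQ).1 (hσ Q hQ).2, one_mul]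
  have hb : ∀ Q ∈ A, b Q * ω Q = ∫⁻ x in Q, g x ∂ω := fun Q hQ => by
    rw [hb_def, mul_comm, ← mul_assoc, ENNReal.mul_inv_cancel (hω Q hQ).1 (hω Q hQ).2, one_mul]
  have hat : ∀ Q ∈ A, a Q ≠ ⊤ := fun Q hQ => by
    refine ENNReal.mul_ne_top (ENNReal.inv_ne_top.2 (hσ Q hQ).1) (ne_top_of_le_ne_top ?_
      (setLIntegral_le_rpow hp hf Q))
    exact ENNReal.mul_ne_top
      (ENNReal.rpow_ne_top_of_nonneg hp.one_div_nonneg (ne_top_of_le_ne_top (by simp) hf1))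
      (ENNReal.rpow_ne_top_of_nonneg hp.symm.one_div_nonneg (hσ Q hQ).2)
  obtain ⟨P, hPA, π, hπ, hd⟩ := hA.exists_principal_parent a
  have hP : Laminar P := hA.mono hPA
  have hPm : ∀ F ∈ P, MeasurableSet F := fun F hF => hm F (hPA hF)
  set S : ℝ≥0∞ := ∑ F ∈ P, a F ^ p * σ F with hS
  have hS1 : S ^ (1 / p) ≤ geomConst (p - 1) := by
    refine (carleson_embedding hp hPm (fun F hF => (hσ F (hPA hF)).2) a
      (fun F hF => hat F (hPA hF)) hf (fun F hF => ha F (hPA hF)) ?_).trans ?_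
    · intro F hF G hG hne x hxF hxG
      rcases hP.subset_or_subset hF hG hxF hxG with h | h
      · exact Or.inr (hd G hG F hF (h.ssubset_of_ne hne))
      · exact Or.inl (hd F hF G hG (h.ssubset_of_ne hne.symm))
    · exact mul_le_of_le_one_right zero_le (ENNReal.rpow_le_one hf1 hp.one_div_nonneg)
  have hS2 : S ≤ geomConst (p - 1) ^ p := by
    calc S = (S ^ (1 / p)) ^ p := by
          rw [← ENNReal.rpow_mul, one_div_mul_cancel hp.ne_zero, ENNReal.rpow_one]
      _ ≤ _ := ENNReal.rpow_le_rpow hS1 hp.nonneg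
  set β : Set X → ℝ≥0∞ := fun F =>
    ∫⁻ x in uncovered P F, g x ^ q' ∂ω + ∑ G ∈ children P F, ω G * b G ^ q' with hβ
  have hβ1 : ∑ F ∈ P, β F ≤ 1 + geomConst (p - 1) ^ p := by
    rw [hβ, Finset.sum_add_distrib]
    refine add_le_add ?_ ?_
    · rw [← lintegral_biUnion_finset]
      · exact (setLIntegral_le_lintegral _ _).trans hg1
      · intro F hF G hG hne
        exact Set.disjoint_left.2 fun x hx hx' => hne (uncovered_eq_of_mem hP hF hG hx hx')
      · exact fun F hF => measurableSet_uncovered hPm hF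
    · refine (sum_children_le _).trans (le_trans ?_ hS2)
      refine Finset.sum_le_sum fun F hF => (hfg F (hPA hF)).trans ?_
      rw [mul_comm]
  have hF : ∀ F ∈ P, ∑ Q ∈ A with π Q = F, lam Q * (∫⁻ x in Q, f x ∂σ) * ∫⁻ x in Q, g x ∂ω ≤
      2 * T * ((a F * σ F ^ (1 / p)) * β F ^ (1 / q')) := by
    intro F hF
    have hBF : ∀ Q ∈ A.filter (π · = F), Q ⊆ F := fun Q hQ => by
      obtain ⟨hQA, hQF⟩ := Finset.mem_filter.1 hQ
      exact hQF ▸ (hπ Q hQA).2.1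
    have hmain := hP.sum_mul_setLIntegral_le (μ := ω) hq (B := A.filter (π · = F)) hPm
      (fun Q hQ => hm Q (Finset.mem_filter.1 hQ).1) hF hBF
      (fun Q hQ G hG hGF x hxG hxQ => by
        obtain ⟨hQA, hQF⟩ := Finset.mem_filter.1 hQ
        rcases hA.subset_or_subset (hPA hG) hQA hxG hxQ with h | h
        · exact h
        · exact (hGF.2 (hQF ▸ (hπ Q hQA).2.2.2 G hG h)).elim)
      (fun Q => lam Q * σ Q) hg b (fun G hG => hb G (hPA hG))
    calc ∑ Q ∈ A with π Q = F, lam Q * (∫⁻ x in Q, f x ∂σ) * ∫⁻ x in Q, g x ∂ω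
        ≤ ∑ Q ∈ A with π Q = F, 2 * a F * (lam Q * σ Q * ∫⁻ x in Q, g x ∂ω) := by
          refine Finset.sum_le_sum fun Q hQ => ?_
          obtain ⟨hQ, hQF⟩ := Finset.mem_filter.1 hQ
          rw [← ha Q hQ]
          calc lam Q * (a Q * σ Q) * ∫⁻ x in Q, g x ∂ω
              = a Q * (lam Q * σ Q * ∫⁻ x in Q, g x ∂ω) := by ring
            _ ≤ _ := mul_le_mul' (hQF ▸ (hπ Q hQ).2.2.1) le_rfl
      _ = 2 * a F * ∑ Q ∈ A with π Q = F, lam Q * σ Q * ∫⁻ x in Q, g x ∂ω :=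
          Finset.mul_sum _ _ _ |>.symm
      _ ≤ 2 * a F * ((T * σ F ^ (1 / p)) * β F ^ (1 / q')) :=
          mul_le_mul' le_rfl (hmain.trans (mul_le_mul'
            (hT F (hPA hF) _ (Finset.filter_subset _ _) hBF) le_rfl))
      _ = _ := by ring
  have hexp : 1 ≤ p' / q' := (one_le_div hq.symm.pos).2 (conj_le_conj hp hq hpq)
  have hexp' : p' / q' * (1 / p') = 1 / q' := by
    have := hp.symm.ne_zero
    field_simp
  calc ∑ Q ∈ A, lam Q * (∫⁻ x in Q, f x ∂σ) * ∫⁻ x in Q, g x ∂ω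
      = ∑ F ∈ P, ∑ Q ∈ A with π Q = F, lam Q * (∫⁻ x in Q, f x ∂σ) * ∫⁻ x in Q, g x ∂ω :=
        (Finset.sum_fiberwise_of_maps_to (fun Q hQ => (hπ Q hQ).1) _).symm
    _ ≤ ∑ F ∈ P, 2 * T * ((a F * σ F ^ (1 / p)) * β F ^ (1 / q')) := Finset.sum_le_sum hF
    _ = 2 * T * ∑ F ∈ P, (a F * σ F ^ (1 / p)) * β F ^ (1 / q') := (Finset.mul_sum _ _ _).symm
    _ ≤ 2 * T * ((∑ F ∈ P, (a F * σ F ^ (1 / p)) ^ p) ^ (1 / p) *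
          (∑ F ∈ P, (β F ^ (1 / q')) ^ p') ^ (1 / p')) :=
        mul_le_mul' le_rfl (ENNReal.inner_le_Lp_mul_Lq _ _ _ hp)
    _ = 2 * T * (S ^ (1 / p) * (∑ F ∈ P, β F ^ (p' / q')) ^ (1 / p')) := by
        simp only [hS, ENNReal.mul_rpow_of_nonneg _ _ hp.nonneg, ← ENNReal.rpow_mul,
          one_div_mul_cancel hp.ne_zero, ENNReal.rpow_one, one_div_mul_eq_div]
    _ ≤ 2 * T * (geomConst (p - 1) * ((1 + geomConst (p - 1) ^ p) ^ (p' / q')) ^ (1 / p')) := by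
        refine mul_le_mul' le_rfl (mul_le_mul' hS1 ?_)
        refine ENNReal.rpow_le_rpow ?_ hp.symm.one_div_nonneg
        exact (sum_rpow_le_rpow_sum P β hexp).trans
          (ENNReal.rpow_le_rpow hβ1 (by linarith))
    _ = testingConst p q' * T := by
        rw [← ENNReal.rpow_mul, hexp', testingConst]
        ring

/-- The two-weight testing estimate for normalized functions. -/
lemma Laminar.bilinear_le_of_normalized {p p' q q' : ℝ} (hp : p.HolderConjugate p')
    (hq : q.HolderConjugate q') (hpq : p ≤ q) {σ ω : Measure X} {A : Finset (Set X)}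
    (hA : Laminar A) (hm : ∀ Q ∈ A, MeasurableSet Q)
    (hσ : ∀ Q ∈ A, σ Q ≠ ⊤) (hω : ∀ Q ∈ A, ω Q ≠ ⊤) (lam : Set X → ℝ≥0∞) (T₁ T₂ : ℝ≥0∞)
    (hT₁ : ∀ R ∈ A, ω R ≠ 0 → ∀ B ⊆ A, (∀ Q ∈ B, Q ⊆ R) →
      (∫⁻ x, (∑ Q ∈ B, Q.indicator (fun _ => lam Q * ω Q) x) ^ p' ∂σ) ^ (1 / p') ≤
        T₁ * ω R ^ (1 / q'))
    (hT₂ : ∀ R ∈ A, σ R ≠ 0 → ∀ B ⊆ A, (∀ Q ∈ B, Q ⊆ R) →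
      (∫⁻ x, (∑ Q ∈ B, Q.indicator (fun _ => lam Q * σ Q) x) ^ q ∂ω) ^ (1 / q) ≤
        T₂ * σ R ^ (1 / p))
    {f g : X → ℝ≥0∞} (hf : Measurable f) (hg : Measurable g) (hf1 : ∫⁻ x, f x ^ p ∂σ ≤ 1)
    (hg1 : ∫⁻ x, g x ^ q' ∂ω ≤ 1) :
    ∑ Q ∈ A, lam Q * (∫⁻ x in Q, f x ∂σ) * ∫⁻ x in Q, g x ∂ω ≤
      (testingConst p q' + testingConst q' p) * (T₁ + T₂) := by
  classical
  set A₀ := A.filter fun Q => σ Q ≠ 0 ∧ ω Q ≠ 0 with hA₀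
  set D : Set X → Prop := fun Q => ω Q * ((ω Q)⁻¹ * ∫⁻ x in Q, g x ∂ω) ^ q' ≤
      σ Q * ((σ Q)⁻¹ * ∫⁻ x in Q, f x ∂σ) ^ p with hD
  have hsub : ∀ Q ∈ A₀, Q ∈ A ∧ σ Q ≠ 0 ∧ ω Q ≠ 0 := fun Q hQ => Finset.mem_filter.1 hQ
  have hs1 : A₀.filter D ⊆ A₀ := Finset.filter_subset _ _
  have hs2 : A₀.filter (¬ D ·) ⊆ A₀ := Finset.filter_subset _ _
  have hs0 : A₀ ⊆ A := Finset.filter_subset _ _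
  have h1 : ∑ Q ∈ A₀.filter D, lam Q * (∫⁻ x in Q, f x ∂σ) * ∫⁻ x in Q, g x ∂ω ≤
      testingConst p q' * T₂ :=
    (hA.mono (hs1.trans hs0)).bilinear_le_of_dominated hp hq hpq
      (fun Q hQ => hm Q (hs0 (hs1 hQ)))
      (fun Q hQ => ⟨(hsub Q (hs1 hQ)).2.1, hσ Q (hs0 (hs1 hQ))⟩)
      (fun Q hQ => ⟨(hsub Q (hs1 hQ)).2.2, hω Q (hs0 (hs1 hQ))⟩) lam T₂
      (fun R hR B hB => hT₂ R (hs0 (hs1 hR)) (hsub R (hs1 hR)).2.1 B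
        (hB.trans (hs1.trans hs0))) hf hg hf1 hg1
      (fun Q hQ => (Finset.mem_filter.1 hQ).2)
  have h2 : ∑ Q ∈ A₀.filter (¬ D ·), lam Q * (∫⁻ x in Q, g x ∂ω) * ∫⁻ x in Q, f x ∂σ ≤
      testingConst q' p * T₁ :=
    (hA.mono (hs2.trans hs0)).bilinear_le_of_dominated hq.symm hp.symm (conj_le_conj hp hq hpq)
      (fun Q hQ => hm Q (hs0 (hs2 hQ)))
      (fun Q hQ => ⟨(hsub Q (hs2 hQ)).2.2, hω Q (hs0 (hs2 hQ))⟩)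
      (fun Q hQ => ⟨(hsub Q (hs2 hQ)).2.1, hσ Q (hs0 (hs2 hQ))⟩) lam T₁
      (fun R hR B hB => hT₁ R (hs0 (hs2 hR)) (hsub R (hs2 hR)).2.2 B
        (hB.trans (hs2.trans hs0))) hg hf hg1 hf1
      (fun Q hQ => (not_le.1 (Finset.mem_filter.1 hQ).2).le)
  calc ∑ Q ∈ A, lam Q * (∫⁻ x in Q, f x ∂σ) * ∫⁻ x in Q, g x ∂ω
      = ∑ Q ∈ A₀, lam Q * (∫⁻ x in Q, f x ∂σ) * ∫⁻ x in Q, g x ∂ω := by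
        refine (Finset.sum_filter_of_ne fun Q hQ hne => ⟨fun h => hne ?_, fun h => hne ?_⟩).symm
        · rw [setLIntegral_measure_zero _ _ h, mul_zero, zero_mul]
        · rw [setLIntegral_measure_zero _ _ h, mul_zero]
    _ = _ := (Finset.sum_filter_add_sum_filter_not A₀ D _).symm
    _ ≤ testingConst p q' * T₂ + testingConst q' p * T₁ := by
        refine add_le_add h1 (le_trans (le_of_eq ?_) h2)
        exact Finset.sum_congr rfl fun Q _ => mul_right_comm _ _ _
    _ ≤ (testingConst p q' + testingConst q' p) * T₂ +
          (testingConst p q' + testingConst q' p) * T₁ :=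
        add_le_add (mul_le_mul' le_self_add le_rfl) (mul_le_mul' le_add_self le_rfl)
    _ = _ := by ring

lemma lintegral_rpow_normalized {μ : Measure X} {p : ℝ} (hp : 0 < p) {f : X → ℝ≥0∞}
    (hf : Measurable f) :
    ∫⁻ x, (((∫⁻ x, f x ^ p ∂μ) ^ (1 / p))⁻¹ * f x) ^ p ∂μ ≤ 1 := by
  simp_rw [ENNReal.mul_rpow_of_nonneg _ _ hp.le]
  rw [lintegral_const_mul _ (hf.pow_const p), ENNReal.inv_rpow, ← ENNReal.rpow_mul,
    one_div_mul_cancel hp.ne', ENNReal.rpow_one]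
  exact ENNReal.inv_mul_le_one _

/-- The two-weight testing estimate in bilinear form. -/
lemma Laminar.bilinear_le {p p' q q' : ℝ} (hp : p.HolderConjugate p')
    (hq : q.HolderConjugate q') (hpq : p ≤ q) {σ ω : Measure X} {A : Finset (Set X)}
    (hA : Laminar A) (hm : ∀ Q ∈ A, MeasurableSet Q)
    (hσ : ∀ Q ∈ A, σ Q ≠ ⊤) (hω : ∀ Q ∈ A, ω Q ≠ ⊤) (lam : Set X → ℝ≥0∞) (T₁ T₂ : ℝ≥0∞)
    (hT₁ : ∀ R ∈ A, ω R ≠ 0 → ∀ B ⊆ A, (∀ Q ∈ B, Q ⊆ R) →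
      (∫⁻ x, (∑ Q ∈ B, Q.indicator (fun _ => lam Q * ω Q) x) ^ p' ∂σ) ^ (1 / p') ≤
        T₁ * ω R ^ (1 / q'))
    (hT₂ : ∀ R ∈ A, σ R ≠ 0 → ∀ B ⊆ A, (∀ Q ∈ B, Q ⊆ R) →
      (∫⁻ x, (∑ Q ∈ B, Q.indicator (fun _ => lam Q * σ Q) x) ^ q ∂ω) ^ (1 / q) ≤
        T₂ * σ R ^ (1 / p))
    {f g : X → ℝ≥0∞} (hf : Measurable f) (hg : Measurable g)
    (hft : (∫⁻ x, f x ^ p ∂σ) ^ (1 / p) ≠ ⊤) (hgt : (∫⁻ x, g x ^ q' ∂ω) ^ (1 / q') ≠ ⊤) :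
    ∑ Q ∈ A, lam Q * (∫⁻ x in Q, f x ∂σ) * ∫⁻ x in Q, g x ∂ω ≤
      (testingConst p q' + testingConst q' p) * (T₁ + T₂) *
        (∫⁻ x, f x ^ p ∂σ) ^ (1 / p) * (∫⁻ x, g x ^ q' ∂ω) ^ (1 / q') := by
  rcases eq_or_ne ((∫⁻ x, f x ^ p ∂σ) ^ (1 / p)) 0 with hf0 | hf0
  · refine (le_of_eq (Finset.sum_eq_zero fun Q _ => ?_)).trans zero_le
    have h := setLIntegral_le_rpow (μ := σ) hp hf Q
    rw [hf0, zero_mul, nonpos_iff_eq_zero] at h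
    rw [h, mul_zero, zero_mul]
  rcases eq_or_ne ((∫⁻ x, g x ^ q' ∂ω) ^ (1 / q')) 0 with hg0 | hg0
  · refine (le_of_eq (Finset.sum_eq_zero fun Q _ => ?_)).trans zero_le
    have h := setLIntegral_le_rpow (μ := ω) hq.symm hg Q
    rw [hg0, zero_mul, nonpos_iff_eq_zero] at h
    rw [h, mul_zero]
  have hf1 := lintegral_rpow_normalized (μ := σ) hp.pos hf
  have hg1 := lintegral_rpow_normalized (μ := ω) hq.symm.pos hg
  set N := (∫⁻ x, f x ^ p ∂σ) ^ (1 / p)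
  set M := (∫⁻ x, g x ^ q' ∂ω) ^ (1 / q')
  have h := hA.bilinear_le_of_normalized hp hq hpq hm hσ hω lam T₁ T₂ hT₁ hT₂
    (hf.const_mul N⁻¹) (hg.const_mul M⁻¹) hf1 hg1
  simp_rw [lintegral_const_mul _ hf, lintegral_const_mul _ hg] at h
  calc ∑ Q ∈ A, lam Q * (∫⁻ x in Q, f x ∂σ) * ∫⁻ x in Q, g x ∂ω
      = N * M * ∑ Q ∈ A, lam Q * (N⁻¹ * ∫⁻ x in Q, f x ∂σ) * (M⁻¹ * ∫⁻ x in Q, g x ∂ω) := by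
        rw [Finset.mul_sum]
        refine Finset.sum_congr rfl fun Q _ => ?_
        calc _ = (N * N⁻¹) * (M * M⁻¹) *
              (lam Q * (∫⁻ x in Q, f x ∂σ) * ∫⁻ x in Q, g x ∂ω) := by
              rw [ENNReal.mul_inv_cancel hf0 hft, ENNReal.mul_inv_cancel hg0 hgt, one_mul, one_mul]
          _ = _ := by ring
    _ ≤ N * M * ((testingConst p q' + testingConst q' p) * (T₁ + T₂)) := mul_le_mul' le_rfl h
    _ = _ := by ring

/-- An `L^q` bound obtained by testing a function against its dual power. -/
lemma rpow_lintegral_le_of_dual {μ : Measure X} {q q' : ℝ} (hq : q.HolderConjugate q')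
    {u : X → ℝ≥0∞} {K : ℝ≥0∞} (hu : ∫⁻ x, u x ^ q ∂μ ≠ ⊤)
    (h : ∫⁻ x, u x * u x ^ (q - 1) ∂μ ≤ K * (∫⁻ x, (u x ^ (q - 1)) ^ q' ∂μ) ^ (1 / q')) :
    (∫⁻ x, u x ^ q ∂μ) ^ (1 / q) ≤ K := by
  refine rpow_le_of_le_mul_rpow hq hu ?_
  have h1 : ∀ x, u x * u x ^ (q - 1) = u x ^ q := fun x => by
    nth_rw 1 [← ENNReal.rpow_one (u x)]
    rw [← ENNReal.rpow_add_of_nonneg _ _ zero_le_one hq.sub_one_pos.le, add_sub_cancel]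
  simpa only [h1, ← ENNReal.rpow_mul, hq.sub_one_mul_conj] using h

lemma lintegral_rpow_sum_indicator_ne_top {μ : Measure X} {B : Finset (Set X)}
    (hB : ∀ Q ∈ B, MeasurableSet Q) (hμ : ∀ Q ∈ B, μ Q ≠ ⊤) {c : Set X → ℝ≥0∞}
    (hc : ∀ Q ∈ B, c Q ≠ ⊤) {q : ℝ} (hq : 0 < q) :
    ∫⁻ x, (∑ Q ∈ B, Q.indicator (fun _ => c Q) x) ^ q ∂μ ≠ ⊤ := by
  classical
  set N := (∑ Q ∈ B, c Q) ^ q with hN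
  have hNt : N ≠ ⊤ := ENNReal.rpow_ne_top_of_nonneg hq.le (ENNReal.sum_ne_top.2 hc)
  have hle : ∫⁻ x, (∑ Q ∈ B, Q.indicator (fun _ => c Q) x) ^ q ∂μ ≤
      ∫⁻ x, ∑ Q ∈ B, Q.indicator (fun _ => N) x ∂μ := by
    refine lintegral_mono fun x => ?_
    by_cases hx : ∃ Q ∈ B, x ∈ Q
    · obtain ⟨Q, hQ, hxQ⟩ := hx
      calc (∑ Q ∈ B, Q.indicator (fun _ => c Q) x) ^ q ≤ N := by
            refine ENNReal.rpow_le_rpow (Finset.sum_le_sum fun R _ => ?_) hq.le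
            exact indicator_le_self' (fun _ _ => zero_le) x
        _ = Q.indicator (fun _ => N) x := by simp [hxQ]
        _ ≤ _ := Finset.single_le_sum (f := fun Q : Set X => Q.indicator (fun _ => N) x)
            (fun _ _ => zero_le) hQ
    · push Not at hx
      rw [Finset.sum_eq_zero fun Q hQ => by simp [hx Q hQ]]
      simp [hq]
  refine ne_top_of_le_ne_top ?_ hle
  rw [lintegral_sum_indicator hB (fun _ => N)]
  exact ENNReal.sum_ne_top.2 fun Q hQ => ENNReal.mul_ne_top hNt (hμ Q hQ)

/-- The two-weight testing estimate in operator form, for a finite laminar family. -/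
lemma Laminar.operator_le {p p' q q' : ℝ} (hp : p.HolderConjugate p')
    (hq : q.HolderConjugate q') (hpq : p ≤ q) {σ ω : Measure X} {A : Finset (Set X)}
    (hA : Laminar A) (hm : ∀ Q ∈ A, MeasurableSet Q)
    (hσ : ∀ Q ∈ A, σ Q ≠ ⊤) (hω : ∀ Q ∈ A, ω Q ≠ ⊤) (lam : Set X → ℝ≥0∞)
    (hlam : ∀ Q ∈ A, lam Q ≠ ⊤) (T₁ T₂ : ℝ≥0∞)
    (hT₁ : ∀ R ∈ A, ω R ≠ 0 → ∀ B ⊆ A, (∀ Q ∈ B, Q ⊆ R) →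
      (∫⁻ x, (∑ Q ∈ B, Q.indicator (fun _ => lam Q * ω Q) x) ^ p' ∂σ) ^ (1 / p') ≤
        T₁ * ω R ^ (1 / q'))
    (hT₂ : ∀ R ∈ A, σ R ≠ 0 → ∀ B ⊆ A, (∀ Q ∈ B, Q ⊆ R) →
      (∫⁻ x, (∑ Q ∈ B, Q.indicator (fun _ => lam Q * σ Q) x) ^ q ∂ω) ^ (1 / q) ≤
        T₂ * σ R ^ (1 / p))
    {f : X → ℝ≥0∞} (hf : Measurable f) (hft : (∫⁻ x, f x ^ p ∂σ) ^ (1 / p) ≠ ⊤) :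
    (∫⁻ x, (∑ Q ∈ A, Q.indicator (fun _ => lam Q * ∫⁻ y in Q, f y ∂σ) x) ^ q ∂ω) ^ (1 / q) ≤
      (testingConst p q' + testingConst q' p) * (T₁ + T₂) * (∫⁻ x, f x ^ p ∂σ) ^ (1 / p) := by
  have hfin : ∀ Q ∈ A, lam Q * ∫⁻ y in Q, f y ∂σ ≠ ⊤ := fun Q hQ =>
    ENNReal.mul_ne_top (hlam Q hQ) (ne_top_of_le_ne_top (ENNReal.mul_ne_top hft
      (ENNReal.rpow_ne_top_of_nonneg hp.symm.one_div_nonneg (hσ Q hQ)))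
      (setLIntegral_le_rpow hp hf Q))
  have hut := lintegral_rpow_sum_indicator_ne_top hm hω hfin hq.pos
  have hum := measurable_sum_indicator hm fun Q => lam Q * ∫⁻ y in Q, f y ∂σ
  refine rpow_lintegral_le_of_dual hq hut ?_
  rw [lintegral_sum_indicator_mul hm _ (hum.pow_const _)]
  refine hA.bilinear_le hp hq hpq hm hσ hω lam T₁ T₂ hT₁ hT₂ hf (hum.pow_const _) hft ?_
  simp only [← ENNReal.rpow_mul, hq.sub_one_mul_conj]
  exact ENNReal.rpow_ne_top_of_nonneg hq.symm.one_div_nonneg hut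

lemma rpow_lintegral_tsum_le {ι : Type*} [Countable ι] {μ : Measure X} {q : ℝ} (hq : 0 < q)
    {u : ι → X → ℝ≥0∞} (hu : ∀ i, Measurable (u i)) {B : ℝ≥0∞}
    (h : ∀ s : Finset ι, (∫⁻ x, (∑ i ∈ s, u i x) ^ q ∂μ) ^ (1 / q) ≤ B) :
    (∫⁻ x, (∑' i, u i x) ^ q ∂μ) ^ (1 / q) ≤ B := by
  classical
  have h1 : ∀ x, (∑' i, u i x) ^ q = ⨆ s : Finset ι, (∑ i ∈ s, u i x) ^ q := fun x => by
    rw [ENNReal.tsum_eq_iSup_sum]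
    exact (ENNReal.orderIsoRpow q hq).map_iSup _
  simp_rw [h1]
  rw [lintegral_iSup_directed
    (fun s => ((Finset.measurable_sum s fun i _ => hu i).pow_const q).aemeasurable)]
  · rw [one_div, ENNReal.rpow_inv_le_iff hq]
    refine iSup_le fun s => ?_
    rw [← ENNReal.rpow_inv_le_iff hq, ← one_div]
    exact h s
  · refine Monotone.directed_le fun s t hst x => ?_
    exact ENNReal.rpow_le_rpow (Finset.sum_le_sum_of_subset hst) hq.le

end LaminarFamilies

namespace Cube

variable {n : ℕ}

/-- The half-open version of the cube. -/
def halfOpen (Q : Cube n) : Set (Fin n → ℝ) :=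
  univ.pi fun i => Ico (Q.corner i) (Q.corner i + Q.side)

lemma mem_halfOpen {Q : Cube n} {x : Fin n → ℝ} :
    x ∈ Q.halfOpen ↔ ∀ i, Q.corner i ≤ x i ∧ x i < Q.corner i + Q.side := by
  simp [halfOpen, Set.mem_pi]

lemma carrier_eq_Icc (Q : Cube n) :
    Q.carrier = Icc Q.corner (fun i => Q.corner i + Q.side) := by
  ext x
  simp [carrier, Pi.le_def, forall_and]

lemma measurableSet_halfOpen (Q : Cube n) : MeasurableSet Q.halfOpen :=
  MeasurableSet.univ_pi fun _ => measurableSet_Ico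

lemma measurableSet_carrier (Q : Cube n) : MeasurableSet Q.carrier := by
  rw [carrier_eq_Icc]
  exact measurableSet_Icc

lemma carrier_ae_eq_halfOpen (Q : Cube n) {μ : Measure (Fin n → ℝ)} (hμ : μ ≪ volume) :
    Q.carrier =ᵐ[μ] Q.halfOpen := by
  rw [carrier_eq_Icc]
  exact hμ.ae_eq (Measure.univ_pi_Ico_ae_eq_Icc (μ := fun _ => volume)).symm

lemma corner_mem_halfOpen (Q : Cube n) : Q.corner ∈ Q.halfOpen :=
  mem_halfOpen.2 fun _ => ⟨le_rfl, by linarith [Q.side_pos]⟩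

lemma carrier_subset_of_halfOpen_subset {Q R : Cube n} (h : Q.halfOpen ⊆ R.halfOpen) :
    Q.carrier ⊆ R.carrier := by
  have h1 := mem_halfOpen.1 (h Q.corner_mem_halfOpen)
  have h2 : ∀ i, Q.corner i + Q.side ≤ R.corner i + R.side := by
    intro i
    refine le_of_forall_lt_imp_le_of_dense fun t ht => ?_
    rcases le_or_gt (Q.corner i) t with hc | hc
    · have hmem : Function.update Q.corner i t ∈ Q.halfOpen := by
        refine mem_halfOpen.2 fun j => ?_
        rcases eq_or_ne j i with rfl | hj
        · simp [hc, ht]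
        · simp [hj, Q.side_pos]
      simpa using ((mem_halfOpen.1 (h hmem)) i).2.le
    · exact hc.le.trans (h1 i).2.le
  exact fun x hx i => ⟨(h1 i).1.trans (hx i).1, (hx i).2.trans (h2 i)⟩

lemma carrier_injective (hn : 1 ≤ n) : Function.Injective (carrier : Cube n → _) := by
  intro Q R h
  have hmem : ∀ S : Cube n, S.corner ∈ S.carrier ∧ (fun i => S.corner i + S.side) ∈ S.carrier :=
    fun S => ⟨fun i => ⟨le_rfl, by linarith [S.side_pos]⟩,
      fun i => ⟨by simpa using S.side_pos.le, le_rfl⟩⟩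
  have h1 : (Q.corner ∈ R.carrier) := h ▸ (hmem Q).1
  have h2 : (R.corner ∈ Q.carrier) := h ▸ (hmem R).1
  have h3 : (fun i => Q.corner i + Q.side) ∈ R.carrier := h ▸ (hmem Q).2
  have h4 : (fun i => R.corner i + R.side) ∈ Q.carrier := h ▸ (hmem R).2
  have hc : Q.corner = R.corner := funext fun i => le_antisymm (h2 i).1 (h1 i).1
  have hs : Q.side = R.side := by
    have h5 := (h3 ⟨0, hn⟩).2
    have h6 := (h4 ⟨0, hn⟩).2
    have h7 := congrFun hc ⟨0, hn⟩
    simp only at h5 h6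
    linarith
  cases Q
  cases R
  simp_all

lemma halfOpen_injective (hn : 1 ≤ n) : Function.Injective (halfOpen : Cube n → _) :=
  fun _ _ h => carrier_injective hn
    ((carrier_subset_of_halfOpen_subset h.le).antisymm (carrier_subset_of_halfOpen_subset h.ge))

lemma IsDyadic.halfOpen_subset {Q R : Cube n} (hQ : Q.IsDyadic) (hR : R.IsDyadic)
    (hs : Q.side ≤ R.side) {x : Fin n → ℝ} (hxQ : x ∈ Q.halfOpen) (hxR : x ∈ R.halfOpen) :
    Q.halfOpen ⊆ R.halfOpen := by
  obtain ⟨j, m, hjs, hm⟩ := hQ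
  obtain ⟨k, l, hks, hl⟩ := hR
  have hjk : k ≤ j := by
    rw [hjs, hks, zpow_le_zpow_iff_right₀ (by norm_num)] at hs
    linarith
  obtain ⟨N, hN⟩ := Int.eq_ofNat_of_zero_le (sub_nonneg.2 hjk)
  have hside : (2 : ℝ) ^ (-k) = ((2 : ℤ) ^ N : ℤ) * (2 : ℝ) ^ (-j) := by
    have : -k = (N : ℤ) + -j := by omega
    rw [this, zpow_add₀ (by norm_num), zpow_natCast]
    push_cast
    rfl
  have hpos : (0 : ℝ) < (2 : ℝ) ^ (-j) := by positivity
  set s : ℝ := (2 : ℝ) ^ (-j)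
  set M : ℤ := 2 ^ N
  rw [mem_halfOpen] at hxQ hxR
  refine fun y hy => mem_halfOpen.2 fun i => ?_
  have hy := (mem_halfOpen.1 hy) i
  have hxQ := hxQ i
  have hxR := hxR i
  rw [hm, hjs] at hxQ hy
  rw [hl, hks, hside] at hxR
  rw [hl, hks, hside]
  have h1 : l i * M < m i + 1 := by
    have : ((l i * M : ℤ) : ℝ) * s < ((m i + 1 : ℤ) : ℝ) * s := by
      push_cast
      nlinarith [hxQ.1, hxQ.2, hxR.1, hxR.2]
    exact_mod_cast lt_of_mul_lt_mul_right this hpos.le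
  have h2 : m i < (l i + 1) * M := by
    have : ((m i : ℤ) : ℝ) * s < (((l i + 1) * M : ℤ) : ℝ) * s := by
      push_cast
      nlinarith [hxQ.1, hxQ.2, hxR.1, hxR.2]
    exact_mod_cast lt_of_mul_lt_mul_right this hpos.le
  have h1' : ((l i * M : ℤ) : ℝ) ≤ m i := by exact_mod_cast Int.lt_add_one_iff.1 h1
  have h2' : ((m i + 1 : ℤ) : ℝ) ≤ ((l i + 1) * M : ℤ) := by exact_mod_cast h2
  push_cast at h1' h2'
  have h3 := mul_le_mul_of_nonneg_right h1' hpos.le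
  have h4 := mul_le_mul_of_nonneg_right h2' hpos.le
  constructor
  · nlinarith [hy.1]
  · nlinarith [hy.2]

lemma countable_isDyadic : {Q : Cube n | Q.IsDyadic}.Countable := by
  let φ : ℤ × (Fin n → ℤ) → Cube n := fun z =>
    ⟨fun i => (z.2 i : ℝ) * (2 : ℝ) ^ (-z.1), (2 : ℝ) ^ (-z.1), by positivity⟩
  refine (countable_range φ).mono ?_
  rintro ⟨c, s, hs⟩ ⟨j, m, hj, hm⟩
  refine ⟨(j, m), ?_⟩
  simp only at hj hm
  simp only [φ, hj]
  congr
  exact (funext hm).symm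

open Classical in
lemma laminar_image_halfOpen {s : Finset (Cube n)} (hs : ∀ Q ∈ s, Q.IsDyadic) :
    Laminar (s.image halfOpen) := by
  constructor
  · intro S hS
    obtain ⟨Q, -, rfl⟩ := Finset.mem_image.1 hS
    exact ⟨_, Q.corner_mem_halfOpen⟩
  · intro S hS S' hS'
    obtain ⟨Q, hQ, rfl⟩ := Finset.mem_image.1 hS
    obtain ⟨R, hR, rfl⟩ := Finset.mem_image.1 hS'
    by_cases hd : Disjoint Q.halfOpen R.halfOpen
    · exact Or.inr (Or.inr hd)
    obtain ⟨x, hxQ, hxR⟩ := Set.not_disjoint_iff.1 hd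
    rcases le_total Q.side R.side with h | h
    · exact Or.inl ((hs Q hQ).halfOpen_subset (hs R hR) h hxQ hxR)
    · exact Or.inr (Or.inl ((hs R hR).halfOpen_subset (hs Q hQ) h hxR hxQ))

end Cube


/-- The measure with density `w` with respect to Lebesgue measure. -/
def weightMeasure {n : ℕ} (w : (Fin n → ℝ) → ℝ) : Measure (Fin n → ℝ) :=
  volume.withDensity fun x => ENNReal.ofReal (w x)

section WeightMeasure

variable {n : ℕ} {w : (Fin n → ℝ) → ℝ} {s : ℝ}

lemma weightMeasure_absolutelyContinuous : weightMeasure w ≪ volume :=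
  withDensity_absolutelyContinuous _ _

lemma IsWeight.aemeasurable (hw : IsWeight w) :
    AEMeasurable (fun x => ENNReal.ofReal (w x)) volume :=
  hw.1.aestronglyMeasurable.aemeasurable.ennreal_ofReal

lemma IsWeight.lintegral_weightMeasure (hw : IsWeight w) {g : (Fin n → ℝ) → ℝ≥0∞}
    (hg : Measurable g) :
    ∫⁻ x, g x ∂weightMeasure w = ∫⁻ x, g x * ENNReal.ofReal (w x) := by
  rw [weightMeasure, lintegral_withDensity_eq_lintegral_mul₀ hw.aemeasurable hg.aemeasurable]
  simp only [Pi.mul_apply, mul_comm]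

lemma IsWeight.setLIntegral_weightMeasure (hw : IsWeight w) {g : (Fin n → ℝ) → ℝ≥0∞}
    (hg : Measurable g) (Q : Cube n) :
    ∫⁻ x in Q.carrier, g x ∂weightMeasure w =
      ∫⁻ x in Q.carrier, g x * ENNReal.ofReal (w x) := by
  rw [← lintegral_indicator Q.measurableSet_carrier, ← lintegral_indicator Q.measurableSet_carrier,
    hw.lintegral_weightMeasure (hg.indicator Q.measurableSet_carrier)]
  simp only [Set.indicator_mul_left]

lemma wMass_eq_carrier (Q : Cube n) : wMass w Q = weightMeasure w Q.carrier :=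
  (withDensity_apply _ Q.measurableSet_carrier).symm

lemma wMass_eq_halfOpen (Q : Cube n) : wMass w Q = weightMeasure w Q.halfOpen :=
  (wMass_eq_carrier Q).trans
    (measure_congr (Q.carrier_ae_eq_halfOpen weightMeasure_absolutelyContinuous))

lemma IsWeight.wMass_ne_top (hw : IsWeight w) (Q : Cube n) : wMass w Q ≠ ⊤ := by
  have h : IntegrableOn w Q.carrier :=
    hw.1.integrableOn_isCompact (Q.carrier_eq_Icc ▸ isCompact_Icc)
  exact h.lintegral_lt_top.ne

lemma IsWeight.eNorm_eq (hw : IsWeight w) {g : (Fin n → ℝ) → ℝ≥0∞} (hg : Measurable g) :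
    eNorm s w g = (∫⁻ x, g x ^ s ∂weightMeasure w) ^ (1 / s) := by
  rw [eNorm, hw.lintegral_weightMeasure (hg.pow_const s)]

lemma IsWeight.wNorm_eq (hw : IsWeight w) (hs : 0 ≤ s) {f : (Fin n → ℝ) → ℝ}
    (hf : Measurable f) :
    wNorm s w f = (∫⁻ x, ENNReal.ofReal |f x| ^ s ∂weightMeasure w) ^ (1 / s) := by
  rw [wNorm, hw.lintegral_weightMeasure (by fun_prop)]
  simp only [ENNReal.ofReal_rpow_of_nonneg (abs_nonneg _) hs]

end WeightMeasure

section CubeSum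

variable {n : ℕ} {D : Set (Cube n)} {c : Cube n → ℝ≥0∞}

lemma measurable_cubeSum (hD : D.Countable) : Measurable (cubeSum D c) := by
  have := hD.to_subtype
  exact Measurable.tsum fun Q : D => measurable_const.indicator Q.1.measurableSet_carrier

lemma sum_le_cubeSum {s : Finset (Cube n)} (hs : ∀ Q ∈ s, Q ∈ D) (x : Fin n → ℝ) :
    ∑ Q ∈ s, Q.carrier.indicator (fun _ => c Q) x ≤ cubeSum D c x := by
  rw [cubeSum, tsum_subtype D (fun Q => Q.carrier.indicator (fun _ => c Q) x)]
  refine le_trans (Finset.sum_le_sum fun Q hQ => ?_) (ENNReal.sum_le_tsum s)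
  rw [Set.indicator_of_mem (hs Q hQ)]

lemma lintegral_sum_carrier_mul {μ : Measure (Fin n → ℝ)} (s : Finset (Cube n))
    {h : (Fin n → ℝ) → ℝ≥0∞} (hh : Measurable h) :
    ∫⁻ x, (∑ Q ∈ s, Q.carrier.indicator (fun _ => c Q) x) * h x ∂μ =
      ∑ Q ∈ s, c Q * ∫⁻ x in Q.carrier, h x ∂μ := by
  simp_rw [Finset.sum_mul]
  rw [lintegral_finsetSum (f := fun Q x => Q.carrier.indicator (fun _ => c Q) x * h x) s
    fun Q _ => (measurable_const.indicator Q.measurableSet_carrier).mul hh]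
  refine Finset.sum_congr rfl fun Q _ => ?_
  rw [← lintegral_const_mul _ hh, ← lintegral_indicator Q.measurableSet_carrier]
  simp only [Set.indicator_mul_left]

lemma cubeSum_le_cubeSum {D' : Set (Cube n)} {c' : Cube n → ℝ≥0∞} (h : D ⊆ D')
    (hc : ∀ Q ∈ D, c Q ≤ c' Q) (x : Fin n → ℝ) : cubeSum D c x ≤ cubeSum D' c' x := by
  refine le_trans (ENNReal.tsum_le_tsum fun Q => ?_)
    (ENNReal.tsum_mono_subtype (f := fun Q : Cube n => Q.carrier.indicator (fun _ => c' Q) x) h)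
  exact Set.indicator_le_indicator (hc Q.1 Q.2)

lemma rpow_lintegral_cubeSum_le (hD : D.Countable) {μ : Measure (Fin n → ℝ)} {q : ℝ} (hq : 0 < q)
    {B : ℝ≥0∞}
    (h : ∀ s : Finset (Cube n), (∀ Q ∈ s, Q ∈ D) →
      (∫⁻ x, (∑ Q ∈ s, Q.carrier.indicator (fun _ => c Q) x) ^ q ∂μ) ^ (1 / q) ≤ B) :
    (∫⁻ x, cubeSum D c x ^ q ∂μ) ^ (1 / q) ≤ B := by
  have := hD.to_subtype
  refine rpow_lintegral_tsum_le hq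
    (fun Q : D => measurable_const.indicator Q.1.measurableSet_carrier) fun s => ?_
  have := h (s.map (Function.Embedding.subtype _)) (by simp +contextual)
  simpa only [Finset.sum_map, Function.Embedding.coe_subtype] using this

open Classical in
lemma lintegral_rpow_sum_carrier (hn : 1 ≤ n) {μ : Measure (Fin n → ℝ)} (hμ : μ ≪ volume) {q : ℝ}
    (s : Finset (Cube n)) (d : Set (Fin n → ℝ) → ℝ≥0∞) (hd : ∀ Q ∈ s, d Q.halfOpen = c Q) :
    ∫⁻ x, (∑ S ∈ s.image Cube.halfOpen, S.indicator (fun _ => d S) x) ^ q ∂μ =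
      ∫⁻ x, (∑ Q ∈ s, Q.carrier.indicator (fun _ => c Q) x) ^ q ∂μ := by
  have h : ∀ᵐ x ∂μ, ∀ Q ∈ s, (x ∈ Q.carrier ↔ x ∈ Q.halfOpen) :=
    (Finset.eventually_all s).2 fun Q _ => (Q.carrier_ae_eq_halfOpen hμ).mem_iff
  refine lintegral_congr_ae ?_
  filter_upwards [h] with x hx
  rw [Finset.sum_image (Cube.halfOpen_injective hn).injOn]
  congr 1
  refine Finset.sum_congr rfl fun Q hQ => ?_
  simp only [Set.indicator_apply, hx Q hQ, hd Q hQ]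

end CubeSum

/-- The coefficient `τ_Q / |Q|` of the positive dyadic operator. -/
def lsuCoeff {n : ℕ} (τ : Cube n → ℝ) (Q : Cube n) : ℝ≥0∞ :=
  ENNReal.ofReal (τ Q) * (ENNReal.ofReal Q.vol)⁻¹

section Operator

variable {n : ℕ} {D : Set (Cube n)} {τ : Cube n → ℝ} {ω σ : (Fin n → ℝ) → ℝ} {p q : ℝ}

lemma lsuCoeff_ne_top (Q : Cube n) : lsuCoeff τ Q ≠ ⊤ :=
  ENNReal.mul_ne_top ENNReal.ofReal_ne_top
    (ENNReal.inv_ne_top.2 (ENNReal.ofReal_pos.2 (pow_pos Q.side_pos n)).ne')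

lemma lsuCoeff_mul (Q : Cube n) (x : ℝ≥0∞) :
    ENNReal.ofReal (τ Q) * ((ENNReal.ofReal Q.vol)⁻¹ * x) = lsuCoeff τ Q * x :=
  (mul_assoc _ _ _).symm

lemma lsuOp_eq (hσ : IsWeight σ) {f : (Fin n → ℝ) → ℝ} (hf : Measurable f) :
    lsuOp D τ σ f = cubeSum D fun Q =>
      lsuCoeff τ Q * ∫⁻ y in Q.carrier, ENNReal.ofReal (f y) ∂weightMeasure σ := by
  unfold lsuOp
  congr 1
  funext Q
  rw [hσ.setLIntegral_weightMeasure hf.ennreal_ofReal, lsuCoeff, mul_assoc]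
  simp only [ENNReal.ofReal_mul' (hσ.2 _)]

/-- Each finite testing sum is controlled by the supremum over the testing cubes. -/
lemma rpow_lintegral_sum_le_of_testing {r t : ℝ} (ht : 0 < t) (hω : IsWeight ω)
    (hσ : IsWeight σ) (hD : D.Countable) {T : ℝ≥0∞}
    (hT : ∀ R ∈ D, wMass σ R ^ (-t) * eNorm r ω
      (cubeSum {Q | Q ∈ D ∧ Q.carrier ⊆ R.carrier} fun Q =>
        ENNReal.ofReal (τ Q) * ((ENNReal.ofReal Q.vol)⁻¹ * wMass σ Q)) ≤ T) (hr : 0 < r)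
    {R : Cube n} (hR : R ∈ D) (hR0 : wMass σ R ≠ 0) (s : Finset (Cube n))
    (hs : ∀ Q ∈ s, Q ∈ D ∧ Q.carrier ⊆ R.carrier) :
    (∫⁻ x, (∑ Q ∈ s, Q.carrier.indicator (fun _ => lsuCoeff τ Q * wMass σ Q) x) ^ r
      ∂weightMeasure ω) ^ (1 / r) ≤ T * wMass σ R ^ t := by
  have hm : wMass σ R ^ t ≠ 0 := by simp [hR0, hσ.wMass_ne_top R]
  have hm' : wMass σ R ^ t ≠ ⊤ := ENNReal.rpow_ne_top_of_nonneg ht.le (hσ.wMass_ne_top R)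
  have h := hT R hR
  rw [hω.eNorm_eq (measurable_cubeSum (hD.mono fun Q hQ => hQ.1)), ENNReal.rpow_neg, mul_comm,
    ← div_eq_mul_inv, ENNReal.div_le_iff hm hm'] at h
  refine le_trans (ENNReal.rpow_le_rpow (lintegral_mono fun x =>
    ENNReal.rpow_le_rpow ?_ hr.le) (by positivity)) h
  simp only [← lsuCoeff_mul]
  exact sum_le_cubeSum hs x

open Classical in
lemma lsuNorm_le {p' q' : ℝ} (hp : p.HolderConjugate p') (hq : q.HolderConjugate q')
    (hpq : p ≤ q) (hn : 1 ≤ n) (hD : ∀ Q ∈ D, Q.IsDyadic) (hω : IsWeight ω) (hσ : IsWeight σ) :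
    lsuNorm p q D τ ω σ ≤ (testingConst p q' + testingConst q' p) *
      (lsuT1 p q D τ ω σ + lsuT2 p q D τ ω σ) := by
  have hDc : D.Countable := Cube.countable_isDyadic.mono hD
  have hp' : p / (p - 1) = p' := hp.conjugate_eq.symm
  have hq' : 1 - 1 / q = 1 / q' := by simpa using hq.one_sub_inv
  refine le_of_forall_gt_imp_ge_of_dense fun K hK => sInf_le fun f hf => ?_
  by_cases hft : wNorm p σ f = ⊤
  · rw [hft, ENNReal.mul_top (zero_le.trans_lt hK).ne']
    exact le_top
  refine le_trans ?_ (mul_le_mul_left hK.le _)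
  have hfle : (∫⁻ x, ENNReal.ofReal (f x) ^ p ∂weightMeasure σ) ^ (1 / p) ≤ wNorm p σ f := by
    rw [hσ.wNorm_eq hp.pos.le hf]
    exact ENNReal.rpow_le_rpow (lintegral_mono fun x => ENNReal.rpow_le_rpow
      (ENNReal.ofReal_le_ofReal (le_abs_self _)) hp.pos.le) (by simpa using hp.pos.le)
  refine le_trans ?_ (mul_le_mul_right hfle _)
  rw [lsuOp_eq hσ hf, hω.eNorm_eq (measurable_cubeSum hDc)]
  refine rpow_lintegral_cubeSum_le hDc hq.pos fun s hs => ?_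
  have hinj := Cube.halfOpen_injective hn
  set lam : Set (Fin n → ℝ) → ℝ≥0∞ := Function.extend Cube.halfOpen (lsuCoeff τ) 0
  have hlam : ∀ Q : Cube n, lam Q.halfOpen = lsuCoeff τ Q := fun Q => hinj.extend_apply _ _ Q
  have hall : ∀ {P : Set (Fin n → ℝ) → Prop}, (∀ Q ∈ s, P Q.halfOpen) →
      ∀ S ∈ s.image Cube.halfOpen, P S := fun h => Finset.forall_mem_image.2 h
  have htest : ∀ {r t : ℝ} {T : ℝ≥0∞} {v w : (Fin n → ℝ) → ℝ}, 0 < t → 0 < r → IsWeight v →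
      IsWeight w → (∀ R ∈ D, wMass v R ^ (-t) * eNorm r w
        (cubeSum {Q | Q ∈ D ∧ Q.carrier ⊆ R.carrier} fun Q =>
          ENNReal.ofReal (τ Q) * ((ENNReal.ofReal Q.vol)⁻¹ * wMass v Q)) ≤ T) →
      ∀ R ∈ s.image Cube.halfOpen, weightMeasure v R ≠ 0 → ∀ B ⊆ s.image Cube.halfOpen,
        (∀ Q ∈ B, Q ⊆ R) →
        (∫⁻ x, (∑ Q ∈ B, Q.indicator (fun _ => lam Q * weightMeasure v Q) x) ^ r
          ∂weightMeasure w) ^ (1 / r) ≤ T * weightMeasure v R ^ t := by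
    intro r t T v w ht hr hv hw hT
    refine hall fun R hR hR0 B hB hBR => ?_
    obtain ⟨s', hs', rfl⟩ := Finset.subset_image_iff.1 hB
    rw [← wMass_eq_halfOpen] at hR0 ⊢
    rw [lintegral_rpow_sum_carrier hn weightMeasure_absolutelyContinuous s'
      (fun S => lam S * weightMeasure v S) (c := fun Q => lsuCoeff τ Q * wMass v Q)
      fun Q _ => by rw [hlam, wMass_eq_halfOpen]]
    refine rpow_lintegral_sum_le_of_testing ht hw hv hDc hT hr (hs R hR) hR0 s' fun Q hQ =>
      ⟨hs Q (hs' hQ), Cube.carrier_subset_of_halfOpen_subset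
        (hBR _ (Finset.mem_image_of_mem _ hQ))⟩
  have hT₁ := htest (T := lsuT1 p q D τ ω σ) (one_div_pos.2 hq.symm.pos) hp.symm.pos hω hσ
    fun R hR => by
      rw [← hp', ← hq']
      exact le_iSup₂ (f := fun R (_ : R ∈ D) => wMass ω R ^ (-(1 - 1 / q)) *
        eNorm (p / (p - 1)) σ (cubeSum {Q | Q ∈ D ∧ Q.carrier ⊆ R.carrier} fun Q =>
          ENNReal.ofReal (τ Q) * ((ENNReal.ofReal Q.vol)⁻¹ * wMass ω Q))) R hR
  have hT₂ := htest (T := lsuT2 p q D τ ω σ) (one_div_pos.2 hp.pos) hq.pos hσ hω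
    fun R hR => le_iSup₂ (f := fun R (_ : R ∈ D) => wMass σ R ^ (-(1 / p)) *
        eNorm q ω (cubeSum {Q | Q ∈ D ∧ Q.carrier ⊆ R.carrier} fun Q =>
          ENNReal.ofReal (τ Q) * ((ENNReal.ofReal Q.vol)⁻¹ * wMass σ Q))) R hR
  have key := Laminar.operator_le hp hq hpq
    (Cube.laminar_image_halfOpen fun Q hQ => hD Q (hs Q hQ))
    (hall fun Q _ => Q.measurableSet_halfOpen)
    (hall fun Q _ => wMass_eq_halfOpen (w := σ) Q ▸ hσ.wMass_ne_top Q)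
    (hall fun Q _ => wMass_eq_halfOpen (w := ω) Q ▸ hω.wMass_ne_top Q) lam
    (hall fun Q _ => (hlam Q).symm ▸ lsuCoeff_ne_top Q) _ _ hT₁ hT₂ hf.ennreal_ofReal
    (ne_top_of_le_ne_top hft hfle)
  rwa [lintegral_rpow_sum_carrier hn weightMeasure_absolutelyContinuous s
    (fun S => lam S * ∫⁻ y in S, ENNReal.ofReal (f y) ∂weightMeasure σ)
    (c := fun Q => lsuCoeff τ Q * ∫⁻ y in Q.carrier, ENNReal.ofReal (f y) ∂weightMeasure σ)
    fun Q _ => by rw [hlam, setLIntegral_congr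
      (Q.carrier_ae_eq_halfOpen weightMeasure_absolutelyContinuous)]] at key

lemma rpow_neg_mul_le {x w K : ℝ≥0∞} {t : ℝ} (ht : 0 < t) (hw : w ≠ ⊤) (h : x ≤ K * w ^ t) :
    w ^ (-t) * x ≤ K := by
  rcases eq_or_ne w 0 with rfl | hw0
  · rw [ENNReal.zero_rpow_of_pos ht, mul_zero, nonpos_iff_eq_zero] at h
    simp [h]
  · rw [ENNReal.rpow_neg, mul_comm, ← div_eq_mul_inv]
    exact ENNReal.div_le_of_le_mul h

lemma lsuT2_le (hp : 0 < p) (hq : 0 < q) (hσ : IsWeight σ) :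
    lsuT2 p q D τ ω σ ≤ lsuNorm p q D τ ω σ := by
  refine le_sInf fun K hK => iSup₂_le fun R hR => ?_
  refine rpow_neg_mul_le (one_div_pos.2 hp) (hσ.wMass_ne_top R) ?_
  have hf : Measurable (R.carrier.indicator fun _ => (1 : ℝ)) :=
    measurable_const.indicator R.measurableSet_carrier
  have hnorm : wNorm p σ (R.carrier.indicator fun _ => (1 : ℝ)) = wMass σ R ^ (1 / p) := by
    have : ∀ x, ENNReal.ofReal |R.carrier.indicator (fun _ => (1 : ℝ)) x| ^ p =
        R.carrier.indicator (fun _ => 1) x := fun x => by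
      by_cases hx : x ∈ R.carrier <;> simp [hx, hp]
    rw [hσ.wNorm_eq hp.le hf, wMass_eq_carrier]
    simp only [this]
    rw [lintegral_indicator_const R.measurableSet_carrier, one_mul]
  rw [← hnorm]
  refine le_trans (ENNReal.rpow_le_rpow (lintegral_mono fun x => mul_le_mul_left
    (ENNReal.rpow_le_rpow ?_ hq.le) _) (one_div_pos.2 hq).le) (hK _ hf)
  rw [lsuOp_eq hσ hf]
  refine cubeSum_le_cubeSum (fun Q hQ => hQ.1) (fun Q hQ => ?_) x
  rw [← lsuCoeff_mul]
  refine mul_le_mul_right (mul_le_mul_right (le_of_eq ?_) _) _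
  rw [wMass_eq_carrier, ← setLIntegral_one]
  refine setLIntegral_congr_fun Q.measurableSet_carrier fun y hy => ?_
  simp [hQ.2 hy]

lemma lsuT1_le {p' q' : ℝ} (hp : p.HolderConjugate p') (hq : q.HolderConjugate q')
    (hDc : D.Countable) (hω : IsWeight ω) (hσ : IsWeight σ) :
    lsuT1 p q D τ ω σ ≤ lsuNorm p q D τ ω σ := by
  have hp' : p / (p - 1) = p' := hp.conjugate_eq.symm
  have hq' : 1 - 1 / q = 1 / q' := by simpa using hq.one_sub_inv
  refine le_sInf fun K hK => iSup₂_le fun R hR => ?_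
  rw [hp', hq']
  refine rpow_neg_mul_le (one_div_pos.2 hq.symm.pos) (hω.wMass_ne_top R) ?_
  have hDR : {Q | Q ∈ D ∧ Q.carrier ⊆ R.carrier}.Countable := hDc.mono fun Q hQ => hQ.1
  rw [hσ.eNorm_eq (measurable_cubeSum hDR)]
  refine rpow_lintegral_cubeSum_le hDR hp.symm.pos fun s hs => ?_
  simp only [lsuCoeff_mul]
  set u : (Fin n → ℝ) → ℝ≥0∞ := fun x =>
    ∑ Q ∈ s, Q.carrier.indicator (fun _ => lsuCoeff τ Q * wMass ω Q) x
  have hum : Measurable u :=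
    Finset.measurable_sum s fun Q _ => measurable_const.indicator Q.measurableSet_carrier
  set N := ∑ Q ∈ s, lsuCoeff τ Q * wMass ω Q with hN
  have hNt : N ≠ ⊤ := ENNReal.sum_ne_top.2 fun Q _ =>
    ENNReal.mul_ne_top (lsuCoeff_ne_top Q) (hω.wMass_ne_top Q)
  have huN : ∀ x, u x ≤ R.carrier.indicator (fun _ => N) x := fun x => by
    by_cases hx : x ∈ R.carrier
    · rw [Set.indicator_of_mem hx]
      exact Finset.sum_le_sum fun Q _ => Set.indicator_le_self _ _ _
    · refine (Finset.sum_eq_zero fun Q hQ => Set.indicator_of_notMem (fun h => ?_) _).le.trans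
        zero_le
      exact hx ((hs Q hQ).2 h)
  have hut : ∀ x, u x ≠ ⊤ := fun x =>
    ne_top_of_le_ne_top hNt ((huN x).trans (Set.indicator_le_self _ _ _))
  have hfin : ∫⁻ x, u x ^ p' ∂weightMeasure σ ≠ ⊤ := by
    refine ne_top_of_le_ne_top (b := N ^ p' * weightMeasure σ R.carrier) ?_ ?_
    · exact ENNReal.mul_ne_top (ENNReal.rpow_ne_top_of_nonneg hp.symm.pos.le hNt)
        (wMass_eq_carrier (w := σ) R ▸ hσ.wMass_ne_top R)
    · rw [← lintegral_indicator_const R.measurableSet_carrier]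
      refine lintegral_mono fun x => ?_
      refine (ENNReal.rpow_le_rpow (huN x) hp.symm.pos.le).trans (le_of_eq ?_)
      by_cases hx : x ∈ R.carrier <;> simp [hx, hp.symm.pos]
  set v : (Fin n → ℝ) → ℝ≥0∞ := fun x => u x ^ (p' - 1)
  have hvm : Measurable v := hum.pow_const _
  have hvt : ∀ x, v x ≠ ⊤ := fun x =>
    ENNReal.rpow_ne_top_of_nonneg hp.symm.sub_one_pos.le (hut x)
  refine rpow_lintegral_le_of_dual hp.symm hfin ?_
  set f : (Fin n → ℝ) → ℝ := fun x => (v x).toReal with hf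
  have hfm : Measurable f := hvm.ennreal_toReal
  have hfv : ∀ x, ENNReal.ofReal (f x) = v x := fun x => ENNReal.ofReal_toReal (hvt x)
  have hnorm : wNorm p σ f = (∫⁻ x, v x ^ p ∂weightMeasure σ) ^ (1 / p) := by
    rw [hσ.wNorm_eq hp.pos.le hfm]
    simp only [hf, abs_of_nonneg ENNReal.toReal_nonneg, ENNReal.ofReal_toReal (hvt _)]
  have hop := lsuOp_eq (D := D) (τ := τ) hσ hfm
  simp only [hfv] at hop
  have hom : Measurable (lsuOp D τ σ f) := hop ▸ measurable_cubeSum hDc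
  calc ∫⁻ x, u x * v x ∂weightMeasure σ
      = ∑ Q ∈ s, (lsuCoeff τ Q * ∫⁻ x in Q.carrier, v x ∂weightMeasure σ) *
          ∫⁻ _ in Q.carrier, 1 ∂(weightMeasure ω).restrict R.carrier := by
        rw [lintegral_sum_carrier_mul s hvm]
        refine Finset.sum_congr rfl fun Q hQ => ?_
        rw [setLIntegral_one, Measure.restrict_apply Q.measurableSet_carrier,
          Set.inter_eq_left.2 (hs Q hQ).2, wMass_eq_carrier, mul_right_comm]
    _ = ∫⁻ x in R.carrier, (∑ Q ∈ s, Q.carrier.indicator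
          (fun _ => lsuCoeff τ Q * ∫⁻ y in Q.carrier, v y ∂weightMeasure σ) x) * 1
          ∂weightMeasure ω := (lintegral_sum_carrier_mul s measurable_const).symm
    _ ≤ ∫⁻ x in R.carrier, lsuOp D τ σ f x ∂weightMeasure ω := by
        refine lintegral_mono fun x => ?_
        rw [mul_one, hop]
        exact sum_le_cubeSum (fun Q hQ => (hs Q hQ).1) x
    _ ≤ eNorm q ω (lsuOp D τ σ f) * wMass ω R ^ (1 / q') := by
        rw [hω.eNorm_eq hom, wMass_eq_carrier]
        exact setLIntegral_le_rpow hq hom _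
    _ ≤ K * wNorm p σ f * wMass ω R ^ (1 / q') := mul_le_mul_left (hK f hfm) _
    _ = K * wMass ω R ^ (1 / q') * (∫⁻ x, v x ^ p ∂weightMeasure σ) ^ (1 / p) := by
        rw [hnorm, mul_right_comm]

end Operator

/-- the Lacey–Sawyer–Uriarte-Tuero two-weight testing characterization of the
norm of positive dyadic operators, with comparability constants depending only on `p`, `q`. -/
theorem stmt6 (p q : ℝ) (hp : 1 < p) (hpq : p ≤ q) :
    ∃ C : ℝ, 0 < C ∧
      ∀ (n : ℕ), 1 ≤ n →
      ∀ (D : Set (Cube n)), (∀ Q ∈ D, Q.IsDyadic) →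
      ∀ τ : Cube n → ℝ, (∀ Q, 0 ≤ τ Q) →
      ∀ ω σ' : (Fin n → ℝ) → ℝ, IsWeight ω → IsWeight σ' →
        lsuNorm p q D τ ω σ' ≤ ENNReal.ofReal C * (lsuT1 p q D τ ω σ' + lsuT2 p q D τ ω σ') ∧
        lsuT1 p q D τ ω σ' + lsuT2 p q D τ ω σ' ≤ ENNReal.ofReal C * lsuNorm p q D τ ω σ' := by
  have hp' : p.HolderConjugate (p / (p - 1)) := Real.HolderConjugate.conjExponent hp
  have hq' : q.HolderConjugate (q / (q - 1)) := Real.HolderConjugate.conjExponent (hp.trans_le hpq)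
  set c := testingConst p (q / (q - 1)) + testingConst (q / (q - 1)) p
  have hc : c ≠ ⊤ := ENNReal.add_ne_top.2
    ⟨testingConst_ne_top hp hq'.symm.pos, testingConst_ne_top hq'.symm.lt hp'.pos⟩
  refine ⟨c.toReal + 2, by positivity, fun n hn D hD τ _ ω σ' hω hσ => ?_⟩
  have hC : ENNReal.ofReal (c.toReal + 2) = c + 2 := by
    rw [ENNReal.ofReal_add ENNReal.toReal_nonneg zero_le_two, ENNReal.ofReal_toReal hc]
    simp
  rw [hC]
  constructor
  · exact (lsuNorm_le hp' hq' hpq hn hD hω hσ).trans (mul_le_mul_left le_self_add _)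
  · calc lsuT1 p q D τ ω σ' + lsuT2 p q D τ ω σ'
        ≤ lsuNorm p q D τ ω σ' + lsuNorm p q D τ ω σ' :=
          add_le_add (lsuT1_le hp' hq' (Cube.countable_isDyadic.mono hD) hω hσ)
            (lsuT2_le hp'.pos hq'.pos hσ)
      _ = 2 * lsuNorm p q D τ ω σ' := (two_mul _).symm
      _ ≤ (c + 2) * lsuNorm p q D τ ω σ' := mul_le_mul_left le_add_self _
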